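/- arXiv:2501.16807 — 3 statements merged into one kernel-verified Lean document; each statement's English description precedes it below -/
import Mathlib

section
/- Let n ≥ 1, t_o ≥ 0, and assume (η) and (v). Let ρ be the unique solution of the nonlocal system on [t_o, T] with datum ρ_o ∈ (L¹ ∩ BV)(ℝ; ℝⁿ). Then ρ is Lipschitz continuous in time with values in L¹: for all t', t'' ∈ [t_o, T], ‖ρ(t') − ρ(t'')‖_{L¹(ℝ;ℝⁿ)} ≤ C |t' − t''|, where C depends only on ‖η‖_{W^{2,∞}(ℝ;ℝ^{n×n})}, sup_{τ∈[t_o,T]} ‖v(τ)‖_{𝒱ⁿ}, ‖ρ_o‖_{L¹}, TV(ρ_o) and T − t_o. -/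
open MeasureTheory Set
open scoped ENNReal NNReal

noncomputable section

/-- `f` belongs to `W^{2,∞}(ℝ;ℝ)` with norm at most `C`. -/
def W2infBound (f : ℝ → ℝ) (C : ℝ) : Prop :=
  ContDiff ℝ 2 f ∧ ∀ x : ℝ,
    |f x| ≤ C ∧ |deriv f x| ≤ C ∧ |deriv (deriv f) x| ≤ C

/-- Assumption (η), quantitative form: every kernel `η_{ij} ∈ W^{2,∞}(ℝ)` with norm `≤ C`. -/
def EtaBound (n : ℕ) (η : Fin n → Fin n → ℝ → ℝ) (C : ℝ) : Prop :=
  ∀ i j : Fin n, W2infBound (η i j) C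

/-- Assumption (η). -/
def EtaAssumption (n : ℕ) (η : Fin n → Fin n → ℝ → ℝ) : Prop :=
  ∃ C : ℝ, EtaBound n η C

/-- `V ∈ 𝒱` with `‖V‖_𝒱 ≤ C`: `V (·, 0)` is bounded and the full space–density
derivative `(∂ₓ V, ∇_ρ V)` lies in `W^{2,∞}`, i.e. all derivatives of order `1,2,3`
of `V` are bounded by `C`. -/
def VBound (n : ℕ) (V : ℝ → (Fin n → ℝ) → ℝ) (C : ℝ) : Prop :=
  ContDiff ℝ 3 (Function.uncurry V) ∧ (∀ x : ℝ, |V x 0| ≤ C) ∧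
    ∀ k : ℕ, 1 ≤ k → k ≤ 3 → ∀ p : ℝ × (Fin n → ℝ),
      ‖iteratedFDeriv ℝ k (Function.uncurry V) p‖ ≤ C

/-- `‖V - W‖_𝒱 ≤ ε`. -/
def VDistLE (n : ℕ) (V W : ℝ → (Fin n → ℝ) → ℝ) (ε : ℝ) : Prop :=
  (∀ x : ℝ, |V x 0 - W x 0| ≤ ε) ∧
    ∀ k : ℕ, 1 ≤ k → k ≤ 3 → ∀ p : ℝ × (Fin n → ℝ),
      ‖iteratedFDeriv ℝ k (Function.uncurry V) p
        - iteratedFDeriv ℝ k (Function.uncurry W) p‖ ≤ ε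

/-- Assumption (v) on the time interval `[t0, T]`: each `v t i ∈ 𝒱` and
`t ↦ v t` is continuous for the `𝒱ⁿ` norm. -/
def VAssumption (n : ℕ) (t0 T : ℝ) (v : ℝ → Fin n → ℝ → (Fin n → ℝ) → ℝ) : Prop :=
  (∀ t ∈ Icc t0 T, ∀ i : Fin n, ∃ C : ℝ, VBound n (v t i) C) ∧
    ∀ t ∈ Icc t0 T, ∀ ε > (0:ℝ), ∃ δ > (0:ℝ), ∀ s ∈ Icc t0 T, |s - t| < δ →
      ∀ i : Fin n, VDistLE n (v s i) (v t i) ε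

/-- The nonlocal term `(η_i * ρ)(x) ∈ ℝⁿ`, `(η_i * ρ)_j (x) = ∫ η_{ij}(ξ) ρ_j (x-ξ) dξ`. -/
def convTerm (n : ℕ) (η : Fin n → Fin n → ℝ → ℝ) (ρ : ℝ → Fin n → ℝ)
    (i : Fin n) (x : ℝ) : Fin n → ℝ :=
  fun j => ∫ ξ : ℝ, η i j ξ * ρ (x - ξ) j

/-- Distributional (weak) solution of `∂_t u + ∂_x (u w) = 0` on `[t0,T] × ℝ`
with initial datum `u0`, tested against all `φ ∈ C_c^∞([t0,T) × ℝ)`. -/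
def IsWeakSol (t0 T : ℝ) (w : ℝ → ℝ → ℝ) (u0 : ℝ → ℝ) (u : ℝ → ℝ → ℝ) : Prop :=
  ∀ φ : ℝ → ℝ → ℝ, ContDiff ℝ (⊤ : ℕ∞) (Function.uncurry φ) →
    HasCompactSupport (Function.uncurry φ) →
    (∀ t : ℝ, T ≤ t → ∀ x : ℝ, φ t x = 0) →
    (∫ t in Icc t0 T, ∫ x : ℝ,
        u t x * (deriv (fun s => φ s x) t + w t x * deriv (fun y => φ t y) x))
      + (∫ x : ℝ, u0 x * φ t0 x) = 0

/-- `ρ ∈ C⁰([t0,T]; L¹(ℝ;ℝⁿ))`. -/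
def ContL1 (n : ℕ) (t0 T : ℝ) (ρ : ℝ → ℝ → Fin n → ℝ) : Prop :=
  (∀ t ∈ Icc t0 T, Integrable (fun x => ρ t x) volume) ∧
    ∀ t ∈ Icc t0 T, ∀ ε > (0:ℝ), ∃ δ > (0:ℝ), ∀ s ∈ Icc t0 T, |s - t| < δ →
      (∫ x : ℝ, ‖ρ s x - ρ t x‖) ≤ ε

/-- Solution of the nonlocal system `∂_t ρ_i + ∂_x (ρ_i v_i(t, x, (η_i * ρ)(t,x))) = 0`
on `[t0,T]`, in the sense of Definition 2.2 of the paper. -/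
def IsSol (n : ℕ) (t0 T : ℝ) (η : Fin n → Fin n → ℝ → ℝ)
    (v : ℝ → Fin n → ℝ → (Fin n → ℝ) → ℝ)
    (ρ0 : ℝ → Fin n → ℝ) (ρ : ℝ → ℝ → Fin n → ℝ) : Prop :=
  ContL1 n t0 T ρ ∧
    ∀ i : Fin n,
      IsWeakSol t0 T (fun t x => v t i x (convTerm n η (ρ t) i x))
        (fun x => ρ0 x i) (fun t x => ρ t x i)

/-- `ρ0 ∈ (L¹ ∩ BV)(ℝ;ℝⁿ)`. -/
def L1BV (n : ℕ) (ρ0 : ℝ → Fin n → ℝ) : Prop :=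
  Integrable (fun x => ρ0 x) volume ∧
    ∀ i : Fin n, BoundedVariationOn (fun x => ρ0 x i) Set.univ

/-- Total variation of an `ℝⁿ`-valued function (componentwise, summed), with values in `ℝ≥0∞`. -/
def TVe (n : ℕ) (u : ℝ → Fin n → ℝ) : ℝ≥0∞ :=
  ∑ i : Fin n, eVariationOn (fun x => u x i) Set.univ

/-- Total variation, real-valued. -/
def TVn (n : ℕ) (u : ℝ → Fin n → ℝ) : ℝ := (TVe n u).toReal

/-- `L¹` norm of an `ℝⁿ`-valued function. -/
def L1n (n : ℕ) (u : ℝ → Fin n → ℝ) : ℝ := ∫ x : ℝ, ‖u x‖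


section Curves
open Filter Topology

structure VF (w wx : ℝ → ℝ → ℝ) (B L L2 : ℝ) : Prop where
  der : ∀ t x, HasDerivAt (w t) (wx t x) x
  cw : Continuous (Function.uncurry w)
  cwx : Continuous (Function.uncurry wx)
  bw : ∀ t x, |w t x| ≤ B
  bL : ∀ t x, |wx t x| ≤ L
  bL2 : ∀ t x y, |wx t x - wx t y| ≤ L2 * |x - y|

def IsCurve (t0 T : ℝ) (w : ℝ → ℝ → ℝ) (X : ℝ → ℝ) : Prop :=
  Continuous X ∧ ∀ s ∈ Icc t0 T, HasDerivAt X (w s (X s)) s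

lemma VF.lip {w wx : ℝ → ℝ → ℝ} {B L L2 : ℝ} (h : VF w wx B L L2) (t x y : ℝ) :
    |w t x - w t y| ≤ L * |x - y| := by
  have := Convex.norm_image_sub_le_of_norm_hasDerivWithin_le (f := w t) (f' := wx t) (C := L)
    (s := univ) (fun x _ => (h.der t x).hasDerivWithinAt) (fun x _ => h.bL t x) convex_univ
    (mem_univ y) (mem_univ x)
  simpa using this

lemma exists_curve {w wx : ℝ → ℝ → ℝ} {B L L2 : ℝ} (h : VF w wx B L L2) (t0 T : ℝ)
    (t : ℝ) (ht : t ∈ Icc t0 T) (y : ℝ) : ∃ X, IsCurve t0 T w X ∧ X t = y := by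
  have hB : 0 ≤ B := (abs_nonneg _).trans (h.bw 0 0)
  have hL : 0 ≤ L := (abs_nonneg _).trans (h.bL 0 0)
  obtain ⟨h1, h2⟩ := ht
  have hle : t0 - 1 ≤ T + 1 := by linarith
  let τ : Icc (t0 - 1) (T + 1) := ⟨t, by constructor <;> linarith⟩
  have hPL : IsPicardLindelof w τ y (Real.toNNReal (B * (T - t0 + 2))) 0 (Real.toNNReal B)
      (Real.toNNReal L) := by
    constructor
    · intro s _
      apply LipschitzWith.lipschitzOnWith
      apply LipschitzWith.of_dist_le_mul
      intro a b
      rw [Real.dist_eq, Real.dist_eq, Real.coe_toNNReal _ hL]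
      exact h.lip s a b
    · intro x _
      exact (h.cw.comp (by fun_prop : Continuous fun s : ℝ => (s, x))).continuousOn
    · intro s _ x _
      rw [Real.coe_toNNReal _ hB]
      exact h.bw s x
    · rw [Real.coe_toNNReal _ hB, Real.coe_toNNReal _ (mul_nonneg hB (by linarith))]
      simp only [NNReal.coe_zero, sub_zero]
      apply mul_le_mul_of_nonneg_left _ hB
      apply max_le <;> simp only [τ] <;> linarith
  obtain ⟨α, hα, hd⟩ := hPL.exists_eq_forall_mem_Icc_hasDerivWithinAt₀
  have hc : ContinuousOn α (Icc (t0 - 1) (T + 1)) := fun s hs => (hd s hs).continuousWithinAt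
  refine ⟨IccExtend hle (restrict (Icc (t0 - 1) (T + 1)) α), ⟨?_, ?_⟩, ?_⟩
  · exact hc.restrict.Icc_extend'
  · intro s hs
    have hs' : s ∈ Icc (t0 - 1) (T + 1) := ⟨by linarith [hs.1], by linarith [hs.2]⟩
    have hn : Icc (t0 - 1) (T + 1) ∈ 𝓝 s :=
      Icc_mem_nhds (by linarith [hs.1]) (by linarith [hs.2])
    rw [IccExtend_of_mem _ _ hs']
    refine ((hd s hs').hasDerivAt hn).congr_of_eventuallyEq ?_
    filter_upwards [hn] with r hr
    rw [IccExtend_of_mem _ _ hr]; rfl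
  · rw [IccExtend_of_mem _ _ τ.2]; exact hα

lemma IsCurve.lip {w wx : ℝ → ℝ → ℝ} {B L L2 : ℝ} (h : VF w wx B L L2) {t0 T : ℝ}
    {X : ℝ → ℝ} (hX : IsCurve t0 T w X) {s r : ℝ} (hs : s ∈ Icc t0 T) (hr : r ∈ Icc t0 T) :
    |X s - X r| ≤ B * |s - r| := by
  have := Convex.norm_image_sub_le_of_norm_hasDerivWithin_le (f := X) (f' := fun s => w s (X s))
    (C := B) (s := Icc t0 T) (fun x hx => (hX.2 x hx).hasDerivWithinAt) (fun x _ => h.bw _ _)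
    (convex_Icc _ _) hr hs
  simpa using this

/-- averaged slope -/
def avs (wx : ℝ → ℝ → ℝ) (X Y : ℝ → ℝ) (s : ℝ) : ℝ :=
  ∫ θ in (0:ℝ)..1, wx s (Y s + θ * (X s - Y s))

lemma avs_cont {w wx : ℝ → ℝ → ℝ} {B L L2 : ℝ} (h : VF w wx B L L2) {X Y : ℝ → ℝ}
    (hX : Continuous X) (hY : Continuous Y) : Continuous (avs wx X Y) := by
  unfold avs
  apply intervalIntegral.continuous_parametric_intervalIntegral_of_continuous'
  exact h.cwx.comp (by fun_prop : Continuous fun p : ℝ × ℝ =>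
    (p.1, Y p.1 + p.2 * (X p.1 - Y p.1)))

lemma avs_eq {w wx : ℝ → ℝ → ℝ} {B L L2 : ℝ} (h : VF w wx B L L2) (X Y : ℝ → ℝ) (s : ℝ) :
    w s (X s) - w s (Y s) = avs wx X Y s * (X s - Y s) := by
  unfold avs
  rw [← intervalIntegral.integral_mul_const]
  have hc : Continuous fun θ : ℝ => wx s (Y s + θ * (X s - Y s)) :=
    h.cwx.comp (by fun_prop : Continuous fun θ : ℝ => (s, Y s + θ * (X s - Y s)))
  rw [intervalIntegral.integral_eq_sub_of_hasDerivAt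
    (f := fun θ => w s (Y s + θ * (X s - Y s)))]
  · simp
  · intro θ _
    have h1 : HasDerivAt (fun θ : ℝ => Y s + θ * (X s - Y s)) (X s - Y s) θ := by
      simpa using ((hasDerivAt_id θ).mul_const (X s - Y s)).const_add (Y s)
    exact (h.der s _).comp θ h1
  · exact (hc.mul continuous_const).intervalIntegrable _ _

lemma avs_bound {w wx : ℝ → ℝ → ℝ} {B L L2 : ℝ} (h : VF w wx B L L2) (X Y : ℝ → ℝ) (s : ℝ) :
    |avs wx X Y s| ≤ L := by
  have := intervalIntegral.norm_integral_le_of_norm_le_const (a := 0) (b := 1) (C := L)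
    (f := fun θ => wx s (Y s + θ * (X s - Y s))) (fun θ _ => h.bL _ _)
  simpa [avs] using this

lemma avs_sub {w wx : ℝ → ℝ → ℝ} {B L L2 : ℝ} (h : VF w wx B L L2) (hL2 : 0 ≤ L2)
    (X Y : ℝ → ℝ) (s : ℝ) :
    |avs wx X Y s - wx s (Y s)| ≤ L2 * |X s - Y s| := by
  have hc : Continuous fun θ : ℝ => wx s (Y s + θ * (X s - Y s)) :=
    h.cwx.comp (by fun_prop : Continuous fun θ : ℝ => (s, Y s + θ * (X s - Y s)))
  have h1 : avs wx X Y s - wx s (Y s)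
      = ∫ θ in (0:ℝ)..1, (wx s (Y s + θ * (X s - Y s)) - wx s (Y s)) := by
    rw [intervalIntegral.integral_sub (hc.intervalIntegrable _ _) (by simp)]
    simp [avs]
  rw [h1]
  have := intervalIntegral.norm_integral_le_of_norm_le_const (a := 0) (b := 1)
    (C := L2 * |X s - Y s|)
    (f := fun θ => wx s (Y s + θ * (X s - Y s)) - wx s (Y s)) (fun θ hθ => by
      rw [uIoc_of_le zero_le_one] at hθ
      refine (h.bL2 _ _ _).trans ?_
      apply mul_le_mul_of_nonneg_left _ hL2
      rw [add_sub_cancel_left, abs_mul, abs_of_pos hθ.1]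
      nlinarith [abs_nonneg (X s - Y s), hθ.2])
  simpa using this

lemma curve_diff {w wx : ℝ → ℝ → ℝ} {B L L2 : ℝ} (h : VF w wx B L L2) {t0 T : ℝ}
    {X Y : ℝ → ℝ} (hX : IsCurve t0 T w X) (hY : IsCurve t0 T w Y) {r s : ℝ}
    (hr : r ∈ Icc t0 T) (hs : s ∈ Icc t0 T) :
    X s - Y s = (X r - Y r) * Real.exp (∫ τ in r..s, avs wx X Y τ) := by
  have hc := avs_cont h hX.1 hY.1
  have hP : ∀ s, HasDerivAt (fun s => ∫ τ in r..s, avs wx X Y τ) (avs wx X Y s) s := fun s =>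
    intervalIntegral.integral_hasDerivAt_right (hc.intervalIntegrable _ _)
      (hc.stronglyMeasurableAtFilter _ _) hc.continuousAt
  let g : ℝ → ℝ := fun s => (X s - Y s) * Real.exp (-∫ τ in r..s, avs wx X Y τ)
  have hg : ∀ s ∈ Icc t0 T, HasDerivAt g 0 s := by
    intro s hs
    have := ((hX.2 s hs).sub (hY.2 s hs)).mul ((hP s).neg.exp)
    refine this.congr_deriv ?_
    simp only [Pi.sub_apply, Pi.neg_apply]
    rw [avs_eq h X Y s]; ring
  have hconst : g s = g r := by
    have := Convex.norm_image_sub_le_of_norm_hasDerivWithin_le (f := g) (f' := fun s => 0)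
      (C := 0) (s := Icc t0 T) (fun x hx => (hg x hx).hasDerivWithinAt) (fun x _ => by simp)
      (convex_Icc _ _) hr hs
    simpa [sub_eq_zero] using this
  have h2 : g r = X r - Y r := by simp [g]
  rw [← h2, ← hconst]
  simp only [g]
  rw [mul_assoc, ← Real.exp_add]
  simp

lemma int_le {f : ℝ → ℝ} {L t0 T r s : ℝ} (hf : ∀ x, |f x| ≤ L)
    (hr : r ∈ Icc t0 T) (hs : s ∈ Icc t0 T) : |∫ τ in r..s, f τ| ≤ L * (T - t0) := by
  have hL : 0 ≤ L := (abs_nonneg _).trans (hf 0)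
  have := intervalIntegral.norm_integral_le_of_norm_le_const (a := r) (b := s) (C := L)
    (f := f) (fun θ _ => hf θ)
  refine this.trans (mul_le_mul_of_nonneg_left ?_ hL)
  rw [abs_le]; constructor <;> linarith [hr.1, hr.2, hs.1, hs.2]

lemma curve_diff_le {w wx : ℝ → ℝ → ℝ} {B L L2 : ℝ} (h : VF w wx B L L2) {t0 T : ℝ}
    {X Y : ℝ → ℝ} (hX : IsCurve t0 T w X) (hY : IsCurve t0 T w Y) {r s : ℝ}
    (hr : r ∈ Icc t0 T) (hs : s ∈ Icc t0 T) :
    |X s - Y s| ≤ |X r - Y r| * Real.exp (L * (T - t0)) := by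
  rw [curve_diff h hX hY hr hs, abs_mul, Real.abs_exp]
  apply mul_le_mul_of_nonneg_left _ (abs_nonneg _)
  exact Real.exp_le_exp.2 ((le_abs_self _).trans (int_le (avs_bound h X Y) hr hs))

end Curves

section CoV
open Filter Topology

lemma abs_int_le {f : ℝ → ℝ} {a b C : ℝ} (h : ∀ x ∈ Set.uIoc a b, |f x| ≤ C) :
    |∫ x in a..b, f x| ≤ C * |b - a| :=
  intervalIntegral.norm_integral_le_of_norm_le_const (f := f) h

lemma cov_integrable {Z J f : ℝ → ℝ} (hZ : ∀ y, HasDerivAt Z (J y) y) (hm : StrictMono Z)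
    (hf : Integrable f) : Integrable (fun y => J y * f (Z y)) := by
  have := (integrableOn_image_iff_integrableOn_deriv_smul_of_monotoneOn (f := Z) (f' := J)
    MeasurableSet.univ (fun x _ => (hZ x).hasDerivWithinAt) (hm.monotone.monotoneOn _) f).1
    hf.integrableOn
  simpa using this

lemma cov_le {Z J f : ℝ → ℝ} (hZ : ∀ y, HasDerivAt Z (J y) y) (hm : StrictMono Z)
    (hf : Integrable f) (h0 : ∀ x, 0 ≤ f x) : ∫ y, J y * f (Z y) ≤ ∫ x, f x := by
  have := integral_image_eq_integral_deriv_smul_of_monotoneOn (f := Z) (f' := J)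
    MeasurableSet.univ (fun x _ => (hZ x).hasDerivWithinAt) (hm.monotone.monotoneOn _) f
  simp only [Measure.restrict_univ, smul_eq_mul] at this
  rw [← this]
  exact setIntegral_le_integral hf (Eventually.of_forall h0)

lemma cov_interval {Z J f : ℝ → ℝ} (hZ : ∀ y, HasDerivAt Z (J y) y) (hm : StrictMono Z)
    (hJ : ∀ y, 0 ≤ J y) {a b : ℝ} (hab : a ≤ b) :
    ∫ y in a..b, J y * f (Z y) = ∫ x in Z a..Z b, f x := by
  rw [intervalIntegral.integral_of_le hab, intervalIntegral.integral_of_le (hm.monotone hab),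
    ← integral_Icc_eq_integral_Ioc, ← integral_Icc_eq_integral_Ioc]
  exact integral_Icc_deriv_smul_of_deriv_nonneg (f := Z) (f' := J)
    (fun x _ => (hZ x).continuousAt.continuousWithinAt) (fun x _ => hZ x) (fun x _ => hJ x) hab

lemma ae_eq_of_interval {f g : ℝ → ℝ} (hf : Integrable f) (hg : Integrable g)
    (h : ∀ a b, a ≤ b → ∫ y in a..b, f y = ∫ y in a..b, g y) : f =ᵐ[volume] g := by
  have h' : ∀ b, ∫ y in (0:ℝ)..b, f y = ∫ y in (0:ℝ)..b, g y := by
    intro b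
    rcases le_total 0 b with hb | hb
    · exact h _ _ hb
    · rw [intervalIntegral.integral_symm, h _ _ hb, ← intervalIntegral.integral_symm]
  filter_upwards [LocallyIntegrable.ae_hasDerivAt_integral hf.locallyIntegrable,
    LocallyIntegrable.ae_hasDerivAt_integral hg.locallyIntegrable] with x hx1 hx2
  have h1 := hx1 0
  simp only [h'] at h1
  exact h1.unique (hx2 0)

/-- integral of the shifted differences of a bounded monotone function -/
lemma mono_shift {V : ℝ → ℝ} {K δ : ℝ} (hV : Monotone V) (hK : ∀ a b, V a - V b ≤ K)
    (hδ : 0 ≤ δ) : Integrable (fun z => V (z + δ) - V (z - δ)) ∧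
      ∫ z, (V (z + δ) - V (z - δ)) ≤ 2 * δ * K := by
  have hi : ∀ a b, IntervalIntegrable V volume a b := fun a b => hV.intervalIntegrable
  have hmp : Monotone fun z => V (z + δ) := fun a b hab => hV (by linarith)
  have hmm : Monotone fun z => V (z - δ) := fun a b hab => hV (by linarith)
  have hip : ∀ a b, IntervalIntegrable (fun z => V (z + δ)) volume a b :=
    fun a b => hmp.intervalIntegrable
  have him : ∀ a b, IntervalIntegrable (fun z => V (z - δ)) volume a b :=
    fun a b => hmm.intervalIntegrable
  have h0 : ∀ z, 0 ≤ V (z + δ) - V (z - δ) := fun z => sub_nonneg.2 (hV (by linarith))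
  have hb : ∀ R : ℝ, 0 ≤ R → ∫ z in (-R)..R, (V (z + δ) - V (z - δ)) ≤ 2 * δ * K := by
    intro R hR
    rw [intervalIntegral.integral_sub (hip _ _) (him _ _),
      intervalIntegral.integral_comp_add_right, intervalIntegral.integral_comp_sub_right]
    have e1 := intervalIntegral.integral_add_adjacent_intervals (hi (-R - δ) (-R + δ))
      (hi (-R + δ) (R + δ))
    have e2 := intervalIntegral.integral_add_adjacent_intervals (hi (-R - δ) (R - δ))
      (hi (R - δ) (R + δ))
    have b1 : ∫ x in (R - δ)..(R + δ), V x ≤ ∫ x in (R - δ)..(R + δ), V (R + δ) :=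
      intervalIntegral.integral_mono_on (by linarith) (hi _ _) (by simp)
        (fun x hx => hV hx.2)
    have b2 : ∫ x in (-R - δ)..(-R + δ), V (-R - δ) ≤ ∫ x in (-R - δ)..(-R + δ), V x :=
      intervalIntegral.integral_mono_on (by linarith) (by simp) (hi _ _)
        (fun x hx => hV hx.1)
    simp only [intervalIntegral.integral_const, smul_eq_mul] at b1 b2
    have := hK (R + δ) (-R - δ)
    nlinarith
  have hint : Integrable (fun z => V (z + δ) - V (z - δ)) := by
    refine integrable_of_intervalIntegral_norm_bounded (l := (atTop : Filter ℕ))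
      (a := fun n => -(n : ℝ)) (b := fun n => (n:ℝ)) (2 * δ * K)
      (fun i => ?_) ?_ tendsto_natCast_atTop_atTop ?_
    · exact ((hip (-(i:ℝ)) i).sub (him (-(i:ℝ)) i)).1
    · exact tendsto_neg_atTop_atBot.comp tendsto_natCast_atTop_atTop
    · refine Eventually.of_forall fun i => ?_
      simp only [Real.norm_of_nonneg (h0 _)]
      exact hb i (by positivity)
  refine ⟨hint, ?_⟩
  have ht := intervalIntegral_tendsto_integral hint (l := (atTop : Filter ℕ))
    (a := fun n => -(n : ℝ)) (b := fun n => (n:ℝ))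
    (tendsto_neg_atTop_atBot.comp tendsto_natCast_atTop_atTop) tendsto_natCast_atTop_atTop
  exact le_of_tendsto' ht fun i => hb i (by positivity)

/-- a BV function has a dominating modulus -/
lemma bv_modulus {u : ℝ → ℝ} (hu : BoundedVariationOn u univ) {δ : ℝ} (hδ : 0 ≤ δ) :
    ∃ g : ℝ → ℝ, Integrable g ∧ (∀ z, 0 ≤ g z) ∧
      (∀ z z', |z - z'| ≤ δ → |u z - u z'| ≤ g z) ∧
      ∫ z, g z ≤ 2 * δ * (eVariationOn u univ).toReal := by
  have hl := hu.locallyBoundedVariationOn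
  let V := variationOnFromTo u univ 0
  have hV : Monotone V := fun a b hab =>
    variationOnFromTo.monotoneOn hl (mem_univ 0) (mem_univ a) (mem_univ b) hab
  have hsub : ∀ a b, V a - V b = variationOnFromTo u univ b a := fun a b =>
    variationOnFromTo.sub_right hl (mem_univ _) (mem_univ _) (mem_univ _)
  have hK : ∀ a b, V a - V b ≤ (eVariationOn u univ).toReal := fun a b => by
    rw [hsub]; exact (le_abs_self _).trans (variationOnFromTo.abs_le_eVariationOn hu)
  obtain ⟨h1, h2⟩ := mono_shift hV hK hδ
  have key : ∀ a b, a ≤ b → |u a - u b| ≤ V b - V a := fun a b hab => by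
    rw [abs_sub_comm]
    exact variationOnFromTo.abs_sub_le_sub_of_le hl (mem_univ _) (mem_univ _) (mem_univ _) hab
  refine ⟨_, h1, fun z => sub_nonneg.2 (hV (by linarith)), ?_, h2⟩
  intro z z' hz
  rw [abs_le] at hz
  rcases le_total z z' with h | h
  · refine (key _ _ h).trans ?_
    have := hV (by linarith : z' ≤ z + δ)
    have := hV (by linarith : z - δ ≤ z)
    linarith
  · rw [abs_sub_comm]
    refine (key _ _ h).trans ?_
    have := hV (by linarith : z ≤ z + δ)
    have := hV (by linarith : z - δ ≤ z')
    linarith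

end CoV

section Zmap
open Filter Topology

variable {w wx : ℝ → ℝ → ℝ} {B L L2 t0 T : ℝ}

/-- the Jacobian -/
def Jf (wx : ℝ → ℝ → ℝ) (t0 t : ℝ) (Φ : ℝ → ℝ → ℝ) (y : ℝ) : ℝ :=
  Real.exp (∫ s in t..t0, wx s (Φ y s))

lemma Z_strictMono (h : VF w wx B L L2) (h0 : t0 ≤ T) {t : ℝ} (ht : t ∈ Icc t0 T)
    {Φ : ℝ → ℝ → ℝ} (hΦ : ∀ y, IsCurve t0 T w (Φ y)) (hΦt : ∀ y, Φ y t = y) :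
    StrictMono fun y => Φ y t0 := by
  intro a b hab
  have := curve_diff h (hΦ b) (hΦ a) ht (left_mem_Icc.2 h0)
  rw [hΦt, hΦt] at this
  have h2 : 0 < Φ b t0 - Φ a t0 := by
    rw [this]; exact mul_pos (by linarith) (Real.exp_pos _)
  simpa using h2

lemma Z_deriv (h : VF w wx B L L2) (hL2 : 0 ≤ L2) (h0 : t0 ≤ T) {t : ℝ} (ht : t ∈ Icc t0 T)
    {Φ : ℝ → ℝ → ℝ} (hΦ : ∀ y, IsCurve t0 T w (Φ y)) (hΦt : ∀ y, Φ y t = y) (y : ℝ) :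
    HasDerivAt (fun y => Φ y t0) (Jf wx t0 t Φ y) y := by
  rw [hasDerivAt_iff_tendsto_slope]
  have e : ∀ᶠ z in 𝓝[≠] y, Real.exp (∫ τ in t..t0, avs wx (Φ z) (Φ y) τ)
      = slope (fun y => Φ y t0) y z := by
    filter_upwards [self_mem_nhdsWithin] with z hz
    have := curve_diff h (hΦ z) (hΦ y) ht (left_mem_Icc.2 h0)
    rw [hΦt, hΦt] at this
    rw [slope_def_field, this]
    have : z - y ≠ 0 := sub_ne_zero.2 hz
    field_simp
  refine Tendsto.congr' e ?_
  refine (Real.continuous_exp.tendsto _).comp ?_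
  refine Tendsto.mono_left ?_ nhdsWithin_le_nhds
  rw [tendsto_iff_dist_tendsto_zero]
  have hcy : Continuous fun s => wx s (Φ y s) :=
    h.cwx.comp (continuous_id.prodMk (hΦ y).1)
  have hb : ∀ z, dist (∫ τ in t..t0, avs wx (Φ z) (Φ y) τ) (∫ s in t..t0, wx s (Φ y s))
      ≤ L2 * (|z - y| * Real.exp (L * (T - t0))) * |t0 - t| := by
    intro z
    rw [Real.dist_eq, ← intervalIntegral.integral_sub
      ((avs_cont h (hΦ z).1 (hΦ y).1).intervalIntegrable _ _) (hcy.intervalIntegrable _ _)]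
    refine abs_int_le fun s hs => ?_
    refine (avs_sub h hL2 _ _ s).trans (mul_le_mul_of_nonneg_left ?_ hL2)
    have hs' : s ∈ Icc t0 T := by
      rw [uIoc_of_ge ht.1] at hs
      exact ⟨hs.1.le, hs.2.trans ht.2⟩
    have := curve_diff_le h (hΦ z) (hΦ y) ht hs'
    rwa [hΦt, hΦt] at this
  refine squeeze_zero (fun _ => dist_nonneg) hb ?_
  have : Continuous fun z : ℝ => L2 * (|z - y| * Real.exp (L * (T - t0))) * |t0 - t| := by
    fun_prop
  have h2 := this.tendsto y
  simpa using h2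

/-- comparison of two endpoints -/
lemma curve_ends (h : VF w wx B L L2) {a b y s : ℝ} (ha : a ∈ Icc t0 T)
    (hb : b ∈ Icc t0 T) (hs : s ∈ Icc t0 T) {X Y : ℝ → ℝ} (hX : IsCurve t0 T w X)
    (hY : IsCurve t0 T w Y) (hXa : X a = y) (hYb : Y b = y) :
    |X s - Y s| ≤ B * |a - b| * Real.exp (L * (T - t0)) := by
  refine (curve_diff_le h hX hY ha hs).trans ?_
  apply mul_le_mul_of_nonneg_right _ (Real.exp_pos _).le
  rw [hXa, ← hYb, abs_sub_comm]
  exact hY.lip h ha hb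

lemma logJ_diff (h : VF w wx B L L2) (hL2 : 0 ≤ L2) (h0 : t0 ≤ T) {a b y : ℝ}
    (ha : a ∈ Icc t0 T) (hb : b ∈ Icc t0 T) {X Y : ℝ → ℝ} (hX : IsCurve t0 T w X)
    (hY : IsCurve t0 T w Y) (hXa : X a = y) (hYb : Y b = y) :
    |(∫ s in a..t0, wx s (X s)) - ∫ s in b..t0, wx s (Y s)| ≤
      (L2 * B * Real.exp (L * (T - t0)) * (T - t0) + L) * |a - b| := by
  have hB : 0 ≤ B := (abs_nonneg _).trans (h.bw 0 0)
  have hcX : Continuous fun s => wx s (X s) := h.cwx.comp (continuous_id.prodMk hX.1)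
  have hcY : Continuous fun s => wx s (Y s) := h.cwx.comp (continuous_id.prodMk hY.1)
  have e : (∫ s in a..t0, wx s (X s)) - ∫ s in b..t0, wx s (Y s)
      = (∫ s in a..t0, (wx s (X s) - wx s (Y s))) + ∫ s in a..b, wx s (Y s) := by
    rw [intervalIntegral.integral_sub (hcX.intervalIntegrable _ _) (hcY.intervalIntegrable _ _),
      ← intervalIntegral.integral_add_adjacent_intervals (hcY.intervalIntegrable a b)
        (hcY.intervalIntegrable b t0)]
    ring
  rw [e]
  have b1 : |∫ s in a..t0, (wx s (X s) - wx s (Y s))| ≤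
      (L2 * (B * |a - b| * Real.exp (L * (T - t0)))) * |t0 - a| := by
    refine abs_int_le fun s hs => ?_
    have hs' : s ∈ Icc t0 T := by
      rw [uIoc_of_ge ha.1] at hs
      exact ⟨hs.1.le, hs.2.trans ha.2⟩
    exact (h.bL2 _ _ _).trans (mul_le_mul_of_nonneg_left
      (curve_ends h ha hb hs' hX hY hXa hYb) hL2)
  have b2 : |∫ s in a..b, wx s (Y s)| ≤ L * |b - a| :=
    abs_int_le fun s hs => h.bL _ _
  have b3 : |t0 - a| ≤ T - t0 := by
    rw [abs_le]; constructor <;> linarith [ha.1, ha.2]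
  have b4 : (L2 * (B * |a - b| * Real.exp (L * (T - t0)))) * |t0 - a| ≤
      (L2 * (B * |a - b| * Real.exp (L * (T - t0)))) * (T - t0) :=
    mul_le_mul_of_nonneg_left b3 (by positivity)
  rw [abs_sub_comm b a] at b2
  calc _ ≤ _ := abs_add_le _ _
    _ ≤ _ := add_le_add (b1.trans b4) b2
    _ = _ := by ring

end Zmap

section Weak
open Filter Topology
open scoped ContDiff

structure L1C (u : ℝ → ℝ → ℝ) : Prop where
  int : ∀ t, Integrable (u t)
  cont : ∀ t, Tendsto (fun s => ∫ x, |u s x - u t x|) (𝓝 t) (𝓝 0)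

lemma int_mul_bdd {f g : ℝ → ℝ} {C : ℝ} (hf : Integrable f) (hg : Continuous g)
    (hC : ∀ x, |g x| ≤ C) : Integrable (fun x => f x * g x) :=
  hf.mul_bdd hg.aestronglyMeasurable (Eventually.of_forall hC)

lemma abs_integral_mul_le {f g : ℝ → ℝ} {C : ℝ} (hf : Integrable f)
    (hC : ∀ x, |g x| ≤ C) : |∫ x, f x * g x| ≤ C * ∫ x, |f x| := by
  rw [← integral_const_mul]
  rw [← Real.norm_eq_abs (∫ x, f x * g x)]
  refine norm_integral_le_of_norm_le (hf.abs.const_mul C) (Eventually.of_forall fun x => ?_)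
  rw [Real.norm_eq_abs, abs_mul, mul_comm]
  exact mul_le_mul_of_nonneg_right (hC x) (abs_nonneg _)

lemma pair_cont {u g : ℝ → ℝ → ℝ} {C : ℝ} (hu : L1C u) (hg : Continuous (Function.uncurry g))
    (hC : ∀ t x, |g t x| ≤ C) : Continuous fun t => ∫ x, u t x * g t x := by
  have hgt : ∀ t, Continuous (g t) := fun t => hg.comp (by fun_prop : Continuous fun x => (t, x))
  rw [continuous_iff_continuousAt]
  intro t
  have e : (fun s => ∫ x, u s x * g s x)
      = fun s => (∫ x, (u s x - u t x) * g s x) + ∫ x, u t x * g s x := by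
    funext s
    have i1 : Integrable fun x => (u s x - u t x) * g s x :=
      int_mul_bdd ((hu.int s).sub (hu.int t)) (hgt s) (hC s)
    rw [← integral_add i1 (int_mul_bdd (hu.int t) (hgt s) (hC s))]
    congr 1; funext x; ring
  have h1 : Tendsto (fun s => ∫ x, (u s x - u t x) * g s x) (𝓝 t) (𝓝 0) := by
    rw [tendsto_zero_iff_abs_tendsto_zero]
    refine squeeze_zero (g := fun s => C * ∫ x, |u s x - u t x|) (fun _ => abs_nonneg _)
      (fun s => ?_) ?_
    · exact abs_integral_mul_le ((hu.int s).sub (hu.int t)) (hC s)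
    · simpa using (hu.cont t).const_mul C
  have h2 : Tendsto (fun s => ∫ x, u t x * g s x) (𝓝 t) (𝓝 (∫ x, u t x * g t x)) := by
    refine tendsto_integral_filter_of_dominated_convergence (fun x => |u t x| * C) ?_ ?_ ?_ ?_
    · exact Eventually.of_forall fun s =>
        (int_mul_bdd (hu.int t) (hgt s) (hC s)).aestronglyMeasurable
    · refine Eventually.of_forall fun s => Eventually.of_forall fun x => ?_
      rw [Real.norm_eq_abs, abs_mul]
      exact mul_le_mul_of_nonneg_left (hC s x) (abs_nonneg _)
    · exact (hu.int t).abs.mul_const C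
    · refine Eventually.of_forall fun x => ?_
      have : Continuous fun s => g s x := hg.comp (by fun_prop : Continuous fun s => (s, x))
      exact (this.tendsto t).const_mul _
  unfold ContinuousAt
  rw [e]
  simpa using h1.add h2

lemma weak_integrated {w wx u : ℝ → ℝ → ℝ} {B L L2 t0 T : ℝ} {u0 : ℝ → ℝ}
    (h : VF w wx B L L2) (hu : L1C u) (h0 : t0 < T)
    (hw : IsWeakSol t0 T w u0 u) {ψ : ℝ → ℝ} (hψ : ContDiff ℝ ∞ ψ)
    (hψc : HasCompactSupport ψ) {t : ℝ} (ht : t ∈ Icc t0 T) :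
    ∫ x, u t x * ψ x = (∫ x, u0 x * ψ x) + ∫ s in t0..t, ∫ x, u s x * (w s x * deriv ψ x) := by
  have hψd : Continuous (deriv ψ) := hψ.continuous_deriv (by simp)
  obtain ⟨C1, hC1⟩ := hψc.exists_bound_of_continuous hψ.continuous
  obtain ⟨C2, hC2⟩ := hψc.deriv.exists_bound_of_continuous hψd
  have hB : 0 ≤ B := (abs_nonneg _).trans (h.bw 0 0)
  have hwt : ∀ t, Continuous (w t) := fun t => h.cw.comp (by fun_prop : Continuous fun x => (t, x))
  set G : ℝ → ℝ := fun t => ∫ x, u t x * ψ x with hG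
  set H : ℝ → ℝ := fun t => ∫ x, u t x * (w t x * deriv ψ x) with hH
  have hGc : Continuous G := pair_cont (g := fun _ x => ψ x) (C := C1) hu
    (hψ.continuous.comp continuous_snd) (fun _ x => hC1 x)
  have hbd : ∀ t x, |w t x * deriv ψ x| ≤ B * C2 := fun t x => by
    rw [abs_mul]; exact mul_le_mul (h.bw _ _) (hC2 x) (abs_nonneg _) hB
  have hHc : Continuous H := pair_cont (g := fun t x => w t x * deriv ψ x) (C := B * C2) hu
    (h.cw.mul (hψd.comp continuous_snd)) hbd
  set G0 : ℝ := ∫ x, u0 x * ψ x with hG0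
  set F : ℝ → ℝ := fun t => G0 + ∫ s in t0..t, H s with hF
  have hFd : ∀ t, HasDerivAt F (H t) t := fun t =>
    (intervalIntegral.integral_hasDerivAt_right (hHc.intervalIntegrable _ _)
      (hHc.stronglyMeasurableAtFilter _ _) hHc.continuousAt).const_add G0
  have hFc : Continuous F := continuous_iff_continuousAt.2 fun t => (hFd t).continuousAt
  -- separated test functions
  have hsep : ∀ χ : ℝ → ℝ, ContDiff ℝ ∞ χ → HasCompactSupport χ → (∀ t, T ≤ t → χ t = 0) →
      ∫ t in t0..T, deriv χ t * (G t - F t) = 0 := by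
    intro χ hχ hχc hχ0
    have hχd : Continuous (deriv χ) := hχ.continuous_deriv (by simp)
    have h1 := hw (fun t x => χ t * ψ x) ?_ ?_ ?_
    · have e1 : ∀ t, (∫ x, u t x * (deriv (fun s => χ s * ψ x) t
          + w t x * deriv (fun y => χ t * ψ y) x)) = deriv χ t * G t + χ t * H t := by
        intro t
        rw [hG, hH]
        simp only
        rw [← integral_const_mul, ← integral_const_mul, ← integral_add]
        · congr 1; funext x
          rw [deriv_mul_const ((hχ.differentiable (by simp)) t),
            deriv_const_mul _ ((hψ.differentiable (by simp)) x)]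
          ring
        · exact (int_mul_bdd (hu.int t) hψ.continuous hC1).const_mul _
        · exact (int_mul_bdd (hu.int t) ((hwt t).mul hψd) (hbd t)).const_mul _
      have e2 : ∫ x, u0 x * (χ t0 * ψ x) = χ t0 * G0 := by
        rw [hG0, ← integral_const_mul]
        congr 1; funext x; ring
      simp only [e1, e2] at h1
      rw [integral_Icc_eq_integral_Ioc, ← intervalIntegral.integral_of_le h0.le] at h1
      have e3 : ∫ t in t0..T, (deriv χ t * F t + χ t * H t) = χ T * F T - χ t0 * F t0 := by
        apply intervalIntegral.integral_eq_sub_of_hasDerivAt (f := fun t => χ t * F t)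
        · intro t _
          exact ((hχ.differentiable (by simp)) t).hasDerivAt.mul (hFd t)
        · exact ((hχd.mul hFc).add (hχ.continuous.mul hHc)).intervalIntegrable _ _
      have e4 : F t0 = G0 := by simp [hF]
      rw [hχ0 T le_rfl, e4] at e3
      have e5 : ∫ t in t0..T, deriv χ t * (G t - F t)
          = (∫ t in t0..T, (deriv χ t * G t + χ t * H t))
            - ∫ t in t0..T, (deriv χ t * F t + χ t * H t) := by
        have i1 : IntervalIntegrable (fun t => deriv χ t * G t + χ t * H t) volume t0 T :=
          ((hχd.mul hGc).add (hχ.continuous.mul hHc)).intervalIntegrable _ _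
        have i2 : IntervalIntegrable (fun t => deriv χ t * F t + χ t * H t) volume t0 T :=
          ((hχd.mul hFc).add (hχ.continuous.mul hHc)).intervalIntegrable _ _
        rw [← intervalIntegral.integral_sub i1 i2]
        congr 1; funext t; ring
      rw [e5, e3]; linarith
    · exact (hχ.comp contDiff_fst).mul (hψ.comp contDiff_snd)
    · refine HasCompactSupport.intro (hχc.isCompact.prod hψc.isCompact) ?_
      rintro ⟨a, b⟩ hab
      simp only [Function.uncurry_apply_pair]
      by_cases ha : a ∈ tsupport χ
      · have : b ∉ tsupport ψ := fun hb => hab ⟨ha, hb⟩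
        rw [image_eq_zero_of_notMem_tsupport this, mul_zero]
      · rw [image_eq_zero_of_notMem_tsupport ha, zero_mul]
    · intro t ht x
      simp [hχ0 t ht]
  have hae : ∀ᵐ t, t ∈ Ioo t0 T → G t - F t = 0 := by
    refine isOpen_Ioo.ae_eq_zero_of_integral_contDiff_smul_eq_zero
      ((hGc.sub hFc).locallyIntegrable.locallyIntegrableOn _) ?_
    intro ζ hζ hζc hζs
    have hζ0 : ∀ t, t ∉ Ioo t0 T → ζ t = 0 := fun t ht =>
      image_eq_zero_of_notMem_tsupport fun hm => ht (hζs hm)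
    let P : ℝ → ℝ := fun t => ∫ s in T..t, ζ s
    have hPd : ∀ t, HasDerivAt P (ζ t) t := fun t =>
      intervalIntegral.integral_hasDerivAt_right (hζ.continuous.intervalIntegrable _ _)
        (hζ.continuous.stronglyMeasurableAtFilter _ _) hζ.continuous.continuousAt
    have hPs : ContDiff ℝ ∞ P := by
      rw [contDiff_infty_iff_deriv]
      refine ⟨fun t => (hPd t).differentiableAt, ?_⟩
      have : deriv P = ζ := funext fun t => (hPd t).deriv
      rwa [this]
    let c : ℝ → ℝ := fun t => Real.smoothTransition (t - t0 + 2)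
    have hc : ContDiff ℝ ∞ c := Real.smoothTransition.contDiff.comp (by fun_prop)
    have hP0 : ∀ t, T ≤ t → P t = 0 := by
      intro t ht
      have : ∫ s in T..t, ζ s = ∫ s in T..t, (0:ℝ) := by
        apply intervalIntegral.integral_congr
        intro s hs
        rw [uIcc_of_le ht] at hs
        exact hζ0 s fun hm => absurd hm.2 (not_lt.2 hs.1)
      simpa [P] using this
    have h2 := hsep (fun t => P t * c t) (hPs.mul hc) ?_ ?_
    · rw [← h2, intervalIntegral.integral_of_le h0.le, ← integral_Icc_eq_integral_Ioc,
        ← setIntegral_eq_integral_of_forall_compl_eq_zero (s := Icc t0 T)]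
      · apply setIntegral_congr_fun measurableSet_Icc
        intro t ht
        have : (fun t => P t * c t) =ᶠ[𝓝 t] P := by
          filter_upwards [Ioi_mem_nhds (show t0 - 1 < t by linarith [ht.1])] with r hr
          have hr' : t0 - 1 < r := hr
          simp only [c]
          rw [Real.smoothTransition.one_of_one_le (by linarith), mul_one]
        simp only
        rw [this.deriv_eq, (hPd t).deriv, smul_eq_mul]
      · intro t ht
        rw [hζ0 t fun hm => ht (Ioo_subset_Icc_self hm), zero_smul]
    · refine HasCompactSupport.intro (isCompact_Icc (a := t0 - 2) (b := T)) ?_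
      intro t ht
      by_cases h3 : T ≤ t
      · simp [hP0 t h3]
      · have : t < t0 - 2 := by
          by_contra h4
          exact ht ⟨not_lt.1 h4, (not_le.1 h3).le⟩
        simp only [c]
        rw [Real.smoothTransition.zero_of_nonpos (by linarith), mul_zero]
    · intro t ht
      simp [hP0 t ht]
  have hEq : EqOn G F (Icc t0 T) := by
    apply Measure.eqOn_Icc_of_ae_eq volume h0.ne _ hGc.continuousOn hFc.continuousOn
    rw [← Measure.restrict_congr_set Ioo_ae_eq_Icc, EventuallyEq, ae_restrict_iff' measurableSet_Ioo]
    filter_upwards [hae] with t ht hm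
    exact sub_eq_zero.1 (ht hm)
  exact hEq ht

lemma weak_initial {w wx u : ℝ → ℝ → ℝ} {B L L2 t0 T : ℝ} {u0 : ℝ → ℝ}
    (h : VF w wx B L L2) (hu : L1C u) (hu0 : Integrable u0) (h0 : t0 < T)
    (hw : IsWeakSol t0 T w u0 u) : u t0 =ᵐ[volume] u0 := by
  refine ae_eq_of_integral_contDiff_smul_eq (hu.int t0).locallyIntegrable hu0.locallyIntegrable ?_
  intro g hg hgc
  have := weak_integrated h hu h0 hw hg hgc (left_mem_Icc.2 h0.le)
  simp only [intervalIntegral.integral_same, add_zero] at this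
  simpa [mul_comm] using this

end Weak

section Mass
open Filter Topology
open scoped ContDiff

lemma stk : ∃ C : ℝ, (∀ z, |deriv Real.smoothTransition z| ≤ C) ∧
    (∀ z, |z * deriv Real.smoothTransition z| ≤ C) ∧
    (∀ z, z < 0 → deriv Real.smoothTransition z = 0) ∧
    (∀ z, 1 < z → deriv Real.smoothTransition z = 0) := by
  have hc : Continuous (deriv Real.smoothTransition) :=
    (Real.smoothTransition.contDiff (n := 1)).continuous_deriv (by simp)
  have hneg : ∀ z, z < 0 → deriv Real.smoothTransition z = 0 := by
    intro z hz
    have : Real.smoothTransition =ᶠ[𝓝 z] fun _ => 0 := by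
      filter_upwards [Iio_mem_nhds hz] with r hr
      exact Real.smoothTransition.zero_of_nonpos (le_of_lt hr)
    rw [this.deriv_eq]; simp
  have hpos : ∀ z, 1 < z → deriv Real.smoothTransition z = 0 := by
    intro z hz
    have : Real.smoothTransition =ᶠ[𝓝 z] fun _ => 1 := by
      filter_upwards [Ioi_mem_nhds hz] with r hr
      exact Real.smoothTransition.one_of_one_le (le_of_lt hr)
    rw [this.deriv_eq]; simp
  have hcs : HasCompactSupport (deriv Real.smoothTransition) := by
    refine HasCompactSupport.intro (isCompact_Icc (a := 0) (b := 1)) fun z hz => ?_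
    by_cases h : z < 0
    · exact hneg z h
    · by_cases h' : 1 < z
      · exact hpos z h'
      · exact absurd ⟨not_lt.1 h, not_lt.1 h'⟩ hz
  obtain ⟨C, hC⟩ := hcs.exists_bound_of_continuous hc
  have hC0 : 0 ≤ C := (norm_nonneg _).trans (hC 0)
  refine ⟨C, hC, fun z => ?_, hneg, hpos⟩
  by_cases h : z < 0
  · rw [hneg z h]; simpa
  · by_cases h' : 1 < z
    · rw [hpos z h']; simpa
    · rw [abs_mul, abs_of_nonneg (not_lt.1 h)]
      have := hC z
      rw [Real.norm_eq_abs] at this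
      nlinarith [abs_nonneg (deriv Real.smoothTransition z), not_lt.1 h, not_lt.1 h']

lemma st_hasDeriv (m z : ℝ) : HasDerivAt (fun z => Real.smoothTransition (m * z))
    (m * deriv Real.smoothTransition (m * z)) z := by
  have h1 : HasDerivAt Real.smoothTransition (deriv Real.smoothTransition (m * z)) (m * z) :=
    ((Real.smoothTransition.contDiff (n := 1)).differentiable (by simp) _).hasDerivAt
  have h2 : HasDerivAt (fun z : ℝ => m * z) m z := by
    simpa using (hasDerivAt_id z).const_mul m
  exact (h1.comp z h2).congr_deriv (mul_comm _ _)

lemma lip_of_deriv {κ κd : ℝ → ℝ} {C : ℝ} (hκ : ∀ z, HasDerivAt κ (κd z) z)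
    (hC : ∀ z, |κd z| ≤ C) (x y : ℝ) : |κ x - κ y| ≤ C * |x - y| := by
  have := Convex.norm_image_sub_le_of_norm_hasDerivWithin_le (f := κ) (f' := κd) (C := C)
    (s := univ) (fun x _ => (hκ x).hasDerivWithinAt) (fun x _ => hC x) convex_univ
    (mem_univ y) (mem_univ x)
  simpa using this

lemma B_deriv {u : ℝ → ℝ → ℝ} (hu : L1C u) {κ κd : ℝ → ℝ} {C0 C : ℝ}
    (hκ : ∀ z, HasDerivAt κ (κd z) z) (hκdc : Continuous κd) (hC0 : ∀ z, |κ z| ≤ C0)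
    (hC : ∀ z, |κd z| ≤ C) {X : ℝ → ℝ} {d t : ℝ} (hX : HasDerivAt X d t) :
    HasDerivAt (fun s => ∫ y, u s y * (κ (X s - y) - κ (X t - y)))
      (d * ∫ y, u t y * κd (X t - y)) t := by
  have hκc : Continuous κ := continuous_iff_continuousAt.2 fun z => (hκ z).continuousAt
  have hbd : ∀ s y, |κ (X s - y) - κ (X t - y)| ≤ C0 + C0 := fun s y =>
    (abs_sub _ _).trans (add_le_add (hC0 _) (hC0 _))
  have hcc : ∀ s, Continuous fun y => κ (X s - y) - κ (X t - y) := fun s => by fun_prop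
  have e : (fun s => ∫ y, u s y * (κ (X s - y) - κ (X t - y)))
      = fun s => (∫ y, u t y * (κ (X s - y) - κ (X t - y)))
        + ∫ y, (u s y - u t y) * (κ (X s - y) - κ (X t - y)) := by
    funext s
    have i1 : Integrable fun y => (u s y - u t y) * (κ (X s - y) - κ (X t - y)) :=
      int_mul_bdd ((hu.int s).sub (hu.int t)) (hcc s) (hbd s)
    rw [← integral_add (int_mul_bdd (hu.int t) (hcc s) (hbd s)) i1]
    congr 1; funext x; ring
  rw [e]
  have h1 : HasDerivAt (fun z => ∫ y, u t y * (κ (z - y) - κ (X t - y)))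
      (∫ y, u t y * κd (X t - y)) (X t) := by
    refine (hasDerivAt_integral_of_dominated_loc_of_deriv_le
      (F := fun z y => u t y * (κ (z - y) - κ (X t - y)))
      (F' := fun z y => u t y * κd (z - y)) (bound := fun y => |u t y| * C)
      (s := univ) univ_mem ?_ ?_ ?_ ?_ ?_ ?_).2
    · refine Eventually.of_forall fun z => ?_
      exact (hu.int t).aestronglyMeasurable.mul
        (by fun_prop : Continuous fun y => κ (z - y) - κ (X t - y)).aestronglyMeasurable
    · exact int_mul_bdd (hu.int t) (hcc t) (hbd t)
    · exact (hu.int t).aestronglyMeasurable.mul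
        (by fun_prop : Continuous fun y => κd (X t - y)).aestronglyMeasurable
    · refine Eventually.of_forall fun y z _ => ?_
      rw [Real.norm_eq_abs, abs_mul]
      exact mul_le_mul_of_nonneg_left (hC _) (abs_nonneg _)
    · exact (hu.int t).abs.mul_const C
    · refine Eventually.of_forall fun y z _ => ?_
      have := ((hκ (z - y)).comp_sub_const z y).sub_const (κ (X t - y))
      exact this.const_mul _
  have h2 := h1.comp t hX
  have h3 : HasDerivAt (fun s => ∫ y, (u s y - u t y) * (κ (X s - y) - κ (X t - y))) 0 t := by
    rw [hasDerivAt_iff_isLittleO]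
    have o1 : (fun s => ∫ y, |u s y - u t y|) =o[𝓝 t] fun _ => (1:ℝ) :=
      (Asymptotics.isLittleO_one_iff ℝ).2 (hu.cont t)
    have o2 := o1.mul_isBigO hX.isBigO_sub
    simp only [one_mul] at o2
    refine (Asymptotics.IsBigO.of_bound C ?_).trans_isLittleO o2
    refine Eventually.of_forall fun s => ?_
    simp only [sub_self, zero_mul, integral_zero, sub_zero, smul_zero, mul_zero]
    have hnn : 0 ≤ ∫ y, |u s y - u t y| := integral_nonneg fun y => abs_nonneg _
    rw [Real.norm_eq_abs, Real.norm_eq_abs, abs_mul (∫ y, |u s y - u t y|), abs_of_nonneg hnn]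
    refine (abs_integral_mul_le (C := C * |X s - X t|) ((hu.int s).sub (hu.int t)) ?_).trans ?_
    · intro y
      have := lip_of_deriv hκ hC (X s - y) (X t - y)
      simpa using this
    · simp only [Pi.sub_apply]
      apply le_of_eq; ring
  have h4 := h2.add h3
  refine h4.congr_deriv ?_
  ring

/-- limits of smoothed indicator pairings -/
lemma lim_ind {v : ℝ → ℝ} (hv : Integrable v) {a b : ℝ} (hab : a ≤ b) :
    Tendsto (fun m : ℕ => ∫ y, v y * (Real.smoothTransition (m * (b - y))
      - Real.smoothTransition (m * (a - y)))) atTop (𝓝 (∫ y in a..b, v y)) := by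
  have hpt : ∀ z : ℝ, Tendsto (fun m : ℕ => Real.smoothTransition (m * z)) atTop
      (𝓝 (if 0 < z then 1 else 0)) := by
    intro z
    split_ifs with h
    · apply tendsto_const_nhds.congr'
      have := (tendsto_natCast_atTop_atTop (R := ℝ)).atTop_mul_const h
      filter_upwards [this.eventually_ge_atTop 1] with m hm
      exact (Real.smoothTransition.one_of_one_le hm).symm
    · apply tendsto_const_nhds.congr
      intro m
      exact (Real.smoothTransition.zero_of_nonpos
        (mul_nonpos_of_nonneg_of_nonpos (by positivity) (not_lt.1 h))).symm
  have e : ∫ y in a..b, v y = ∫ y, v y * ((if 0 < b - y then 1 else 0)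
      - (if 0 < a - y then 1 else 0)) := by
    rw [intervalIntegral.integral_of_le hab, integral_Ioc_eq_integral_Ioo,
      ← integral_Ico_eq_integral_Ioo, ← integral_indicator measurableSet_Ico]
    congr 1; funext y
    simp only [indicator, mem_Ico, sub_pos]
    by_cases h1 : y < a
    · simp [h1, h1.trans_le hab, not_le.2 h1]
    · by_cases h2 : y < b
      · simp [h1, h2, not_lt.1 h1]
      · simp [h1, h2]
  rw [e]
  have hst : ∀ z, |Real.smoothTransition z| ≤ 1 := fun z => by
    rw [abs_of_nonneg (Real.smoothTransition.nonneg z)]; exact Real.smoothTransition.le_one z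
  have hstc := Real.smoothTransition.continuous
  refine tendsto_integral_filter_of_dominated_convergence (fun x => |v x| * 2) ?_ ?_ ?_ ?_
  · exact Eventually.of_forall fun m => hv.aestronglyMeasurable.mul
      (by fun_prop : Continuous fun y : ℝ => Real.smoothTransition (m * (b - y))
      - Real.smoothTransition (m * (a - y))).aestronglyMeasurable
  · refine Eventually.of_forall fun m => Eventually.of_forall fun x => ?_
    rw [Real.norm_eq_abs, abs_mul]
    apply mul_le_mul_of_nonneg_left _ (abs_nonneg _)
    refine (abs_sub _ _).trans ?_
    linarith [hst (m * (b - x)), hst (m * (a - x))]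
  · exact hv.abs.mul_const 2
  · exact Eventually.of_forall fun y => ((hpt _).sub (hpt _)).const_mul _

/-- error term -/
def er (w u : ℝ → ℝ → ℝ) (X : ℝ → ℝ) (m : ℝ) (s : ℝ) : ℝ :=
  ∫ y, u s y * ((w s (X s) - w s y) * (m * deriv Real.smoothTransition (m * (X s - y))))

variable {w wx u : ℝ → ℝ → ℝ} {B L L2 t0 T : ℝ}

lemma er_bd (h : VF w wx B L L2) {C : ℝ}
    (hC : ∀ z, |z * deriv Real.smoothTransition z| ≤ C) (X : ℝ → ℝ) {m : ℝ} (hm : 0 ≤ m)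
    (s y : ℝ) :
    |(w s (X s) - w s y) * (m * deriv Real.smoothTransition (m * (X s - y)))| ≤ L * C := by
  have hL : 0 ≤ L := (abs_nonneg _).trans (h.bL 0 0)
  rw [abs_mul]
  have h1 := h.lip s (X s) y
  have h2 := hC (m * (X s - y))
  rw [abs_mul, abs_mul, abs_of_nonneg hm] at h2
  rw [abs_mul, abs_of_nonneg hm]
  calc _ ≤ L * |X s - y| * (m * |deriv Real.smoothTransition (m * (X s - y))|) :=
        mul_le_mul_of_nonneg_right h1 (by positivity)
    _ = L * (m * |X s - y| * |deriv Real.smoothTransition (m * (X s - y))|) := by ring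
    _ ≤ L * C := mul_le_mul_of_nonneg_left h2 hL

lemma st_dc : Continuous (deriv Real.smoothTransition) :=
  (Real.smoothTransition.contDiff (n := 1)).continuous_deriv (by simp)

lemma er_cont (h : VF w wx B L L2) (hu : L1C u) {X : ℝ → ℝ} (hX : Continuous X) {m : ℝ}
    (hm : 0 ≤ m) : Continuous (er w u X m) := by
  obtain ⟨C, -, hC, -, -⟩ := stk
  refine pair_cont (g := fun s y => (w s (X s) - w s y) *
    (m * deriv Real.smoothTransition (m * (X s - y)))) hu ?_ (er_bd h hC X hm)
  have h1 : Continuous fun p : ℝ × ℝ => w p.1 (X p.1) :=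
    h.cw.comp (by fun_prop : Continuous fun p : ℝ × ℝ => (p.1, X p.1))
  have h3 := st_dc
  have h2 : Continuous fun p : ℝ × ℝ => m * deriv Real.smoothTransition (m * (X p.1 - p.2)) := by
    fun_prop
  exact (h1.sub h.cw).mul h2

lemma er_lim (h : VF w wx B L L2) (hu : L1C u) (X : ℝ → ℝ) (s : ℝ) :
    Tendsto (fun m : ℕ => er w u X m s) atTop (𝓝 0) := by
  obtain ⟨C, -, hC, hneg, hpos⟩ := stk
  have : (0:ℝ) = ∫ _y : ℝ, (0:ℝ) := by simp
  rw [this]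
  have h3 := st_dc
  have hwt : Continuous (w s) := h.cw.comp (by fun_prop : Continuous fun x => (s, x))
  refine tendsto_integral_filter_of_dominated_convergence (fun x => |u s x| * (L * C)) ?_ ?_ ?_ ?_
  · refine Eventually.of_forall fun m => (hu.int s).aestronglyMeasurable.mul
      (by fun_prop : Continuous fun y => (w s (X s) - w s y) *
    (m * deriv Real.smoothTransition (m * (X s - y)))).aestronglyMeasurable
  · refine Eventually.of_forall fun m => Eventually.of_forall fun x => ?_
    rw [Real.norm_eq_abs, abs_mul]
    exact mul_le_mul_of_nonneg_left (er_bd h hC X (by positivity) s x) (abs_nonneg _)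
  · exact (hu.int s).abs.mul_const _
  · refine Eventually.of_forall fun y => tendsto_const_nhds.congr' ?_
    rcases lt_trichotomy (X s) y with h1 | h1 | h1
    · filter_upwards [eventually_gt_atTop 0] with m hm
      rw [hneg]
      · simp
      · exact mul_neg_of_pos_of_neg (by exact_mod_cast hm) (by linarith)
    · simp [h1]
    · have := (tendsto_natCast_atTop_atTop (R := ℝ)).atTop_mul_const (sub_pos.2 h1)
      filter_upwards [this.eventually_gt_atTop 1] with m hm
      rw [hpos _ hm]; simp

lemma f_deriv (h : VF w wx B L L2) (hu : L1C u) {u0 : ℝ → ℝ} (h0 : t0 < T)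
    (hw : IsWeakSol t0 T w u0 u) {X Y : ℝ → ℝ} (hX : IsCurve t0 T w X) (hY : IsCurve t0 T w Y)
    {m : ℝ} (hm : 0 < m) {t : ℝ} (ht : t ∈ Ioo t0 T) :
    HasDerivAt (fun s => ∫ y, u s y * (Real.smoothTransition (m * (Y s - y))
      - Real.smoothTransition (m * (X s - y)))) (er w u Y m t - er w u X m t) t := by
  obtain ⟨C, hC1, hC, hneg, hpos⟩ := stk
  have ht' := Ioo_subset_Icc_self ht
  set κ : ℝ → ℝ := fun z => Real.smoothTransition (m * z) with hκ
  set κd : ℝ → ℝ := fun z => m * deriv Real.smoothTransition (m * z) with hκd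
  have hd : ∀ z, HasDerivAt κ (κd z) z := st_hasDeriv m
  have h3 := st_dc
  have hκdc : Continuous κd := by fun_prop
  have hκc : Continuous κ := continuous_iff_continuousAt.2 fun z => (hd z).continuousAt
  have hb0 : ∀ z, |κ z| ≤ 1 := fun z => by
    rw [hκ, abs_of_nonneg (Real.smoothTransition.nonneg _)]
    exact Real.smoothTransition.le_one _
  have hb1 : ∀ z, |κd z| ≤ m * C := fun z => by
    rw [hκd, abs_mul, abs_of_pos hm]
    exact mul_le_mul_of_nonneg_left (hC1 _) hm.le
  have dX := B_deriv hu hd hκdc hb0 hb1 (hX.2 t ht')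
  have dY := B_deriv hu hd hκdc hb0 hb1 (hY.2 t ht')
  set ψ : ℝ → ℝ := fun y => κ (Y t - y) - κ (X t - y) with hψ
  have hκs : ContDiff ℝ ∞ κ := Real.smoothTransition.contDiff.comp (by fun_prop)
  have hψs : ContDiff ℝ ∞ ψ :=
    (hκs.comp (by fun_prop)).sub (hκs.comp (by fun_prop))
  have hψc : HasCompactSupport ψ := by
    refine HasCompactSupport.intro
      (isCompact_Icc (a := min (X t) (Y t) - 1 / m) (b := max (X t) (Y t))) fun y hy => ?_
    simp only [hψ, hκ]
    by_cases h1 : max (X t) (Y t) < y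
    · rw [max_lt_iff] at h1
      rw [Real.smoothTransition.zero_of_nonpos, Real.smoothTransition.zero_of_nonpos, sub_zero]
      · exact mul_nonpos_of_nonneg_of_nonpos hm.le (by linarith)
      · exact mul_nonpos_of_nonneg_of_nonpos hm.le (by linarith)
    · have h2 : y < min (X t) (Y t) - 1 / m := by
        by_contra h4
        exact hy ⟨not_lt.1 h4, not_lt.1 h1⟩
      have h5 : ∀ z, min (X t) (Y t) ≤ z → 1 ≤ m * (z - y) := by
        intro z hz
        have : 1 / m ≤ z - y := by linarith
        rw [div_le_iff₀ hm] at this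
        linarith
      rw [Real.smoothTransition.one_of_one_le (h5 _ (min_le_right _ _)),
        Real.smoothTransition.one_of_one_le (h5 _ (min_le_left _ _)), sub_self]
  have hψd : ∀ y, deriv ψ y = κd (X t - y) - κd (Y t - y) := by
    intro y
    have a1 : HasDerivAt (fun y => κ (Y t - y)) (-κd (Y t - y)) y := by
      simpa using (hd (Y t - y)).comp_const_sub (Y t) y
    have a2 : HasDerivAt (fun y => κ (X t - y)) (-κd (X t - y)) y := by
      simpa using (hd (X t - y)).comp_const_sub (X t) y
    have := (a1.sub a2).deriv
    rw [show ψ = (fun y => κ (Y t - y)) - fun y => κ (X t - y) from rfl, this]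
    ring
  have hB : 0 ≤ B := (abs_nonneg _).trans (h.bw 0 0)
  have hψdc : Continuous (deriv ψ) := hψs.continuous_deriv (by simp)
  obtain ⟨C2, hC2⟩ := hψc.deriv.exists_bound_of_continuous hψdc
  have hHc : Continuous fun s => ∫ x, u s x * (w s x * deriv ψ x) :=
    pair_cont (g := fun t x => w t x * deriv ψ x) (C := B * C2) hu
    (h.cw.mul (hψdc.comp continuous_snd)) (fun t x => by
      rw [abs_mul]; exact mul_le_mul (h.bw _ _) (hC2 x) (abs_nonneg _) hB)
  have dG : HasDerivAt (fun s => ∫ y, u s y * ψ y) (∫ x, u t x * (w t x * deriv ψ x)) t := by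
    have := (intervalIntegral.integral_hasDerivAt_right (hHc.intervalIntegrable t0 t)
      (hHc.stronglyMeasurableAtFilter _ _) hHc.continuousAt).const_add (∫ x, u0 x * ψ x)
    refine this.congr_of_eventuallyEq ?_
    filter_upwards [Icc_mem_nhds ht.1 ht.2] with s hs
    exact weak_integrated h hu h0 hw hψs hψc hs
  have e : (fun s => ∫ y, u s y * (κ (Y s - y) - κ (X s - y)))
      = fun s => (∫ y, u s y * ψ y) + (∫ y, u s y * (κ (Y s - y) - κ (Y t - y)))
        - ∫ y, u s y * (κ (X s - y) - κ (X t - y)) := by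
    funext s
    have bb : ∀ p q y, |κ (p - y) - κ (q - y)| ≤ 1 + 1 := fun p q y =>
      (abs_sub _ _).trans (add_le_add (hb0 _) (hb0 _))
    have i1 : Integrable fun y => u s y * ψ y :=
      int_mul_bdd (hu.int s) hψs.continuous (bb _ _)
    have i2 : Integrable fun y => u s y * (κ (Y s - y) - κ (Y t - y)) :=
      int_mul_bdd (hu.int s) (by fun_prop) (bb _ _)
    have i3 : Integrable fun y => u s y * (κ (X s - y) - κ (X t - y)) :=
      int_mul_bdd (hu.int s) (by fun_prop) (bb _ _)
    have i12 : Integrable fun y => u s y * ψ y + u s y * (κ (Y s - y) - κ (Y t - y)) := i1.add i2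
    rw [← integral_add i1 i2, ← integral_sub i12 i3]
    congr 1; funext y
    simp only [hψ]; ring
  have hfin := (dG.add dY).sub dX
  have key := hfin.congr_deriv (g' := er w u Y m t - er w u X m t) ?_
  · show HasDerivAt (fun s => ∫ y, u s y * (κ (Y s - y) - κ (X s - y))) _ t
    rw [e]; exact key
  · have hwt : Continuous (w t) := h.cw.comp (by fun_prop : Continuous fun x => (t, x))
    have j : ∀ z : ℝ, Integrable fun y => u t y * κd (z - y) := fun z =>
      int_mul_bdd (hu.int t) (by fun_prop) (fun y => hb1 _)
    have j2 : ∀ z : ℝ, Integrable fun y => u t y * (w t y * κd (z - y)) := fun z =>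
      int_mul_bdd (C := B * (m * C)) (hu.int t) (by fun_prop) (fun y => by
        rw [abs_mul]; exact mul_le_mul (h.bw _ _) (hb1 _) (abs_nonneg _) hB)
    have er_eq : ∀ X : ℝ → ℝ, er w u X m t = w t (X t) * (∫ y, u t y * κd (X t - y))
        - ∫ y, u t y * (w t y * κd (X t - y)) := by
      intro X
      unfold er
      rw [← integral_const_mul, ← integral_sub ((j _).const_mul _) (j2 _)]
      congr 1; funext y; simp only [hκd]; ring
    rw [er_eq, er_eq]
    have : ∫ x, u t x * (w t x * deriv ψ x) = (∫ y, u t y * (w t y * κd (X t - y)))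
        - ∫ y, u t y * (w t y * κd (Y t - y)) := by
      rw [← integral_sub (j2 _) (j2 _)]
      congr 1; funext y; rw [hψd]; ring
    rw [this]; ring

lemma mass (h : VF w wx B L L2) (hu : L1C u) {u0 : ℝ → ℝ} (h0 : t0 < T)
    (hw : IsWeakSol t0 T w u0 u) {X Y : ℝ → ℝ} (hX : IsCurve t0 T w X) (hY : IsCurve t0 T w Y)
    {t : ℝ} (ht : t ∈ Icc t0 T) (hXY : X t ≤ Y t) :
    ∫ y in (X t)..(Y t), u t y = ∫ y in (X t0)..(Y t0), u t0 y := by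
  have hXY0 : X t0 ≤ Y t0 := by
    have := curve_diff h hY hX ht (left_mem_Icc.2 h0.le)
    have h2 : 0 ≤ Y t0 - X t0 := by
      rw [this]; exact mul_nonneg (by linarith) (Real.exp_pos _).le
    linarith
  obtain ⟨C, hC1, hC, hneg, hpos⟩ := stk
  have l1 := lim_ind (hu.int t) hXY
  have l2 := lim_ind (hu.int t0) hXY0
  have l3 := l1.sub l2
  have hst : ∀ z, |Real.smoothTransition z| ≤ 1 := fun z => by
    rw [abs_of_nonneg (Real.smoothTransition.nonneg z)]; exact Real.smoothTransition.le_one z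
  have hstc := Real.smoothTransition.continuous
  have hXc := hX.1
  have hYc := hY.1
  have l4 : Tendsto (fun m : ℕ => ∫ s in t0..t, (er w u Y m s - er w u X m s)) atTop (𝓝 0) := by
    have : (0:ℝ) = ∫ _s in t0..t, (0:ℝ) := by simp
    rw [this]
    have hN : Continuous fun s => ∫ y, |u s y| := by
      rw [continuous_iff_continuousAt]
      intro r
      have := hu.cont r
      rw [ContinuousAt, tendsto_iff_dist_tendsto_zero]
      refine squeeze_zero (fun _ => dist_nonneg) (fun s => ?_) this
      rw [Real.dist_eq, ← integral_sub (hu.int s).abs (hu.int r).abs]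
      refine (abs_integral_le_integral_abs).trans ?_
      refine integral_mono ((hu.int s).abs.sub (hu.int r).abs).abs
        ((hu.int s).sub (hu.int r)).abs fun y => ?_
      exact abs_abs_sub_abs_le_abs_sub _ _
    refine intervalIntegral.tendsto_integral_filter_of_dominated_convergence
      (fun s => 2 * (L * C * ∫ y, |u s y|)) ?_ ?_ ?_ ?_
    · refine Eventually.of_forall fun m => ?_
      exact ((er_cont h hu hYc (by positivity)).sub
        (er_cont h hu hXc (by positivity))).aestronglyMeasurable
    · refine Eventually.of_forall fun m => Eventually.of_forall fun s _ => ?_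
      have b : ∀ X : ℝ → ℝ, |er w u X m s| ≤ L * C * ∫ y, |u s y| := fun X =>
        abs_integral_mul_le (hu.int s) (er_bd h hC X (by positivity) s)
      rw [Real.norm_eq_abs]
      refine (abs_sub _ _).trans ?_
      linarith [b X, b Y]
    · exact (by fun_prop : Continuous fun s => 2 * (L * C * ∫ y, |u s y|)).intervalIntegrable _ _
    · refine Eventually.of_forall fun s _ => ?_
      simpa using (er_lim h hu Y s).sub (er_lim h hu X s)
  have e : ∀ᶠ m : ℕ in atTop, ∫ s in t0..t, (er w u Y m s - er w u X m s)
      = (∫ y, u t y * (Real.smoothTransition (m * (Y t - y))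
          - Real.smoothTransition (m * (X t - y))))
        - ∫ y, u t0 y * (Real.smoothTransition (m * (Y t0 - y))
          - Real.smoothTransition (m * (X t0 - y))) := by
    filter_upwards [eventually_gt_atTop 0] with m hm
    have hm' : (0:ℝ) < m := by exact_mod_cast hm
    refine intervalIntegral.integral_eq_sub_of_hasDerivAt_of_le (f := fun s =>
      ∫ y, u s y * (Real.smoothTransition (m * (Y s - y))
          - Real.smoothTransition (m * (X s - y)))) ht.1 ?_ ?_ ?_
    · refine (pair_cont (g := fun s y => Real.smoothTransition (m * (Y s - y))
          - Real.smoothTransition (m * (X s - y))) (C := 2) hu ?_ ?_).continuousOn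
      · show Continuous fun p : ℝ × ℝ => Real.smoothTransition (m * (Y p.1 - p.2))
          - Real.smoothTransition (m * (X p.1 - p.2))
        fun_prop
      · intro s y
        refine (abs_sub _ _).trans ?_
        linarith [hst (m * (Y s - y)), hst (m * (X s - y))]
    · intro s hs
      exact f_deriv h hu h0 hw hX hY hm' ⟨hs.1, hs.2.trans_le ht.2⟩
    · exact ((er_cont h hu hYc hm'.le).sub (er_cont h hu hXc hm'.le)).intervalIntegrable _ _
  have l5 := l4.congr' e
  exact sub_eq_zero.1 (tendsto_nhds_unique l3 l5)

end Mass

section Lin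
open Filter Topology

variable {w wx u : ℝ → ℝ → ℝ} {B L L2 t0 T : ℝ}

lemma exp_diff {p q K : ℝ} (hp : p ≤ K) (hq : q ≤ K) :
    |Real.exp p - Real.exp q| ≤ Real.exp K * |p - q| := by
  have key : ∀ p q : ℝ, p ≤ K → q ≤ K → q ≤ p →
      |Real.exp p - Real.exp q| ≤ Real.exp K * |p - q| := by
    intro p q hp hq hpq
    rw [abs_of_nonneg (sub_nonneg.2 (Real.exp_le_exp.2 hpq)), abs_of_nonneg (sub_nonneg.2 hpq)]
    have h1 : Real.exp q = Real.exp p * Real.exp (q - p) := by rw [← Real.exp_add]; congr 1; ring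
    have h2 := Real.add_one_le_exp (q - p)
    have h3 := Real.exp_le_exp.2 hp
    have h4 := Real.exp_pos p
    rw [h1]
    calc Real.exp p - Real.exp p * Real.exp (q - p) = Real.exp p * (1 - Real.exp (q - p)) := by ring
      _ ≤ Real.exp p * (p - q) := mul_le_mul_of_nonneg_left (by linarith) h4.le
      _ ≤ _ := mul_le_mul_of_nonneg_right h3 (by linarith)
  rcases le_total q p with h | h
  · exact key p q hp hq h
  · rw [abs_sub_comm, abs_sub_comm p]; exact key q p hq hp h

lemma rep (h : VF w wx B L L2) (hL2 : 0 ≤ L2) (hu : L1C u) {u0 : ℝ → ℝ} (hu0 : Integrable u0)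
    (h0 : t0 < T) (hw : IsWeakSol t0 T w u0 u) {t : ℝ} (ht : t ∈ Icc t0 T)
    {Φ : ℝ → ℝ → ℝ} (hΦ : ∀ y, IsCurve t0 T w (Φ y)) (hΦt : ∀ y, Φ y t = y) :
    u t =ᵐ[volume] fun y => Jf wx t0 t Φ y * u0 (Φ y t0) := by
  have hZ := Z_deriv h hL2 h0.le ht hΦ hΦt
  have hm := Z_strictMono h h0.le ht hΦ hΦt
  refine ae_eq_of_interval (hu.int t) (cov_integrable hZ hm hu0) fun a b hab => ?_
  have h1 := cov_interval (f := u0) hZ hm (fun y => (Real.exp_pos _).le) hab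
  have h2 := mass h hu h0 hw (hΦ a) (hΦ b) ht (by rw [hΦt, hΦt]; exact hab)
  rw [hΦt, hΦt] at h2
  rw [h1, h2]
  apply intervalIntegral.integral_congr_ae
  filter_upwards [weak_initial h hu hu0 h0 hw] with x hx _ using hx

lemma lin_L1 (h : VF w wx B L L2) (hL2 : 0 ≤ L2) (hu : L1C u) {u0 : ℝ → ℝ} (hu0 : Integrable u0)
    (h0 : t0 < T) (hw : IsWeakSol t0 T w u0 u) {t : ℝ} (ht : t ∈ Icc t0 T) :
    ∫ x, |u t x| ≤ ∫ x, |u0 x| := by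
  choose Φ hΦ hΦt using exists_curve h t0 T t ht
  have hZ := Z_deriv h hL2 h0.le ht hΦ hΦt
  have hm := Z_strictMono h h0.le ht hΦ hΦt
  have := cov_le hZ hm hu0.abs (fun x => abs_nonneg _)
  refine le_trans (le_of_eq ?_) this
  apply integral_congr_ae
  filter_upwards [rep h hL2 hu hu0 h0 hw ht hΦ hΦt] with y hy
  rw [hy, abs_mul, Jf, Real.abs_exp]

lemma lin_lip (h : VF w wx B L L2) (hL2 : 0 ≤ L2) (hB : 0 ≤ B) (hL : 0 ≤ L)
    (hu : L1C u) {u0 : ℝ → ℝ} (hu0 : Integrable u0)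
    (hbv : BoundedVariationOn u0 univ)
    (h0 : t0 < T) (hw : IsWeakSol t0 T w u0 u) {M V D : ℝ} (hM : ∫ x, |u0 x| ≤ M)
    (hV : (eVariationOn u0 univ).toReal ≤ V) (hD : T - t0 ≤ D)
    {a b : ℝ} (ha : a ∈ Icc t0 T) (hb : b ∈ Icc t0 T) :
    ∫ x, |u a x - u b x| ≤ (Real.exp (L * D) ^ 2 * (2 * (B * Real.exp (L * D)) * V
      + (L2 * B * Real.exp (L * D) * D + L) * M)) * |a - b| := by
  choose Φ hΦ hΦt using exists_curve h t0 T a ha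
  choose Ψ hΨ hΨt using exists_curve h t0 T b hb
  have hZ := Z_deriv h hL2 h0.le ha hΦ hΦt
  have hm := Z_strictMono h h0.le ha hΦ hΦt
  set E := Real.exp (L * D) with hE
  have hE0 : 0 < E := Real.exp_pos _
  have hEE : Real.exp (L * (T - t0)) ≤ E :=
    Real.exp_le_exp.2 (mul_le_mul_of_nonneg_left hD hL)
  set K := L2 * B * E * D + L with hK
  have hD0 : 0 ≤ D := by linarith
  have hM0 : 0 ≤ M := (integral_nonneg fun x => abs_nonneg _).trans hM
  have hV0 : 0 ≤ V := ENNReal.toReal_nonneg.trans hV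
  have hK0 : 0 ≤ K := by positivity
  have hδ : 0 ≤ B * E * |a - b| := by positivity
  obtain ⟨g, hg, hg0, hgm, hgi⟩ := bv_modulus hbv hδ
  have t0m : t0 ∈ Icc t0 T := left_mem_Icc.2 h0.le
  have Jlo : ∀ y, 1 ≤ E * Jf wx t0 a Φ y := by
    intro y
    have := int_le (f := fun s => wx s (Φ y s)) (fun s => h.bL s (Φ y s)) ha t0m
    rw [Jf, hE, ← Real.exp_add]
    apply Real.one_le_exp
    have h2 := (abs_le.1 this).1
    have := mul_le_mul_of_nonneg_left hD hL
    linarith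
  have up : ∀ c ∈ Icc t0 T, ∀ X : ℝ → ℝ, (∫ s in c..t0, wx s (X s)) ≤ L * D := by
    intro c hc X
    have := int_le (f := fun s => wx s (X s)) (fun s => h.bL s (X s)) hc t0m
    have h2 := (abs_le.1 this).2
    have := mul_le_mul_of_nonneg_left hD hL
    linarith
  have Jd : ∀ y, |Jf wx t0 a Φ y - Jf wx t0 b Ψ y| ≤ E * (K * |a - b|) := by
    intro y
    refine (exp_diff (up a ha _) (up b hb _)).trans ?_
    refine mul_le_mul_of_nonneg_left ?_ hE0.le
    refine (logJ_diff h hL2 h0.le ha hb (hΦ y) (hΨ y) (hΦt y) (hΨt y)).trans ?_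
    refine mul_le_mul_of_nonneg_right ?_ (abs_nonneg _)
    rw [hK]
    have : 0 ≤ T - t0 := by linarith
    gcongr
  have Zd : ∀ y, |Φ y t0 - Ψ y t0| ≤ B * E * |a - b| := by
    intro y
    refine (curve_ends h ha hb t0m (hΦ y) (hΨ y) (hΦt y) (hΨt y)).trans ?_
    have := mul_le_mul_of_nonneg_left hEE (mul_nonneg hB (abs_nonneg (a - b)))
    linarith
  have pt : ∀ y, |Jf wx t0 a Φ y * u0 (Φ y t0) - Jf wx t0 b Ψ y * u0 (Ψ y t0)| ≤
      E ^ 2 * (Jf wx t0 a Φ y * g (Φ y t0)) +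
        E ^ 2 * (K * |a - b|) * (Jf wx t0 a Φ y * |u0 (Φ y t0)|) := by
    intro y
    have e : Jf wx t0 a Φ y * u0 (Φ y t0) - Jf wx t0 b Ψ y * u0 (Ψ y t0)
      = Jf wx t0 b Ψ y * (u0 (Φ y t0) - u0 (Ψ y t0))
        + (Jf wx t0 a Φ y - Jf wx t0 b Ψ y) * u0 (Φ y t0) := by ring
    rw [e]
    refine (abs_add_le _ _).trans (add_le_add ?_ ?_)
    · rw [abs_mul, Jf, Real.abs_exp]
      have h1 : Real.exp (∫ s in b..t0, wx s (Ψ y s)) ≤ E := Real.exp_le_exp.2 (up b hb _)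
      have h2 := hgm _ _ (Zd y)
      have h3 := Jlo y
      have h4 := hg0 (Φ y t0)
      calc _ ≤ E * g (Φ y t0) := mul_le_mul h1 h2 (abs_nonneg _) hE0.le
        _ = (E * g (Φ y t0)) * 1 := by ring
        _ ≤ (E * g (Φ y t0)) * (E * Jf wx t0 a Φ y) :=
            mul_le_mul_of_nonneg_left h3 (mul_nonneg hE0.le h4)
        _ = _ := by ring
    · rw [abs_mul]
      have h3 := Jlo y
      calc _ ≤ (E * (K * |a - b|)) * |u0 (Φ y t0)| :=
            mul_le_mul_of_nonneg_right (Jd y) (abs_nonneg _)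
        _ = ((E * (K * |a - b|)) * |u0 (Φ y t0)|) * 1 := by ring
        _ ≤ ((E * (K * |a - b|)) * |u0 (Φ y t0)|) * (E * Jf wx t0 a Φ y) :=
            mul_le_mul_of_nonneg_left h3 (by positivity)
        _ = _ := by ring
  have i1 := cov_integrable hZ hm hg
  have i2 := cov_integrable hZ hm hu0.abs
  have c1 := cov_le hZ hm hg hg0
  have c2 := cov_le hZ hm hu0.abs fun x => abs_nonneg _
  have hae : ∀ᵐ x, |u a x - u b x| ≤ E ^ 2 * (Jf wx t0 a Φ x * g (Φ x t0)) +
        E ^ 2 * (K * |a - b|) * (Jf wx t0 a Φ x * |u0 (Φ x t0)|) := by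
    filter_upwards [rep h hL2 hu hu0 h0 hw ha hΦ hΦt, rep h hL2 hu hu0 h0 hw hb hΨ hΨt] with y h1 h2
    rw [h1, h2]; exact pt y
  have := integral_mono_ae ((hu.int a).sub (hu.int b)).abs
    ((i1.const_mul (E ^ 2)).add (i2.const_mul (E ^ 2 * (K * |a - b|)))) hae
  refine this.trans ?_
  simp only [Pi.add_apply]
  rw [integral_add (i1.const_mul (E ^ 2)) (i2.const_mul (E ^ 2 * (K * |a - b|))),
    integral_const_mul, integral_const_mul]
  have f1 : (∫ y, Jf wx t0 a Φ y * g (Φ y t0)) ≤ 2 * (B * E * |a - b|) * V :=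
    c1.trans (hgi.trans (mul_le_mul_of_nonneg_left hV (by positivity)))
  have f2 : (∫ y, Jf wx t0 a Φ y * |u0 (Φ y t0)|) ≤ M := c2.trans hM
  calc _ ≤ E ^ 2 * (2 * (B * E * |a - b|) * V) + E ^ 2 * (K * |a - b|) * M := by
        gcongr
    _ = _ := by ring

end Lin

section Fields
open Filter Topology

lemma conv_bd {u : ℝ → ℝ} (hu : Integrable u) {κ : ℝ → ℝ} {C R : ℝ} (hC0 : 0 ≤ C)
    (hC : ∀ z, |κ z| ≤ C) (hR : ∫ y, |u y| ≤ R) (x : ℝ) :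
    |∫ y, u y * κ (x - y)| ≤ C * R :=
  (abs_integral_mul_le hu fun y => hC (x - y)).trans (mul_le_mul_of_nonneg_left hR hC0)

lemma conv_diff {u u' : ℝ → ℝ} (hu : Integrable u) (hu' : Integrable u') {κ : ℝ → ℝ} {C R : ℝ}
    (hC0 : 0 ≤ C) (hκ : Continuous κ)
    (hC : ∀ z, |κ z| ≤ C) (hl : ∀ x y, |κ x - κ y| ≤ C * |x - y|)
    (hR : ∫ y, |u' y| ≤ R) (x z : ℝ) :
    |(∫ y, u y * κ (x - y)) - ∫ y, u' y * κ (z - y)| ≤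
      C * (∫ y, |u y - u' y|) + C * R * |x - z| := by
  have i1 : ∀ f : ℝ → ℝ, Integrable f → ∀ x, Integrable fun y => f y * κ (x - y) := fun f hf x =>
    int_mul_bdd hf (by fun_prop : Continuous fun y => κ (x - y)) fun y => hC _
  have e : (∫ y, u y * κ (x - y)) - ∫ y, u' y * κ (z - y)
      = (∫ y, (u y - u' y) * κ (x - y)) + ∫ y, u' y * (κ (x - y) - κ (z - y)) := by
    rw [← integral_sub (i1 u hu x) (i1 u' hu' z), ← integral_add]
    · congr 1; funext y; ring
    · exact i1 _ (hu.sub hu') x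
    · have := (i1 u' hu' x).sub (i1 u' hu' z)
      refine this.congr (Eventually.of_forall fun y => ?_)
      simp only [Pi.sub_apply]; ring
  rw [e]
  refine (abs_add_le _ _).trans (add_le_add ?_ ?_)
  · exact abs_integral_mul_le (f := fun y => u y - u' y) (hu.sub hu') fun y => hC _
  · refine (abs_integral_mul_le (C := C * |x - z|) hu' fun y => ?_).trans ?_
    · simpa using hl (x - y) (z - y)
    · calc _ ≤ C * |x - z| * R := mul_le_mul_of_nonneg_left hR (by positivity)
        _ = _ := by ring

lemma conv_cont {u : ℝ → ℝ → ℝ} (hu : L1C u) {κ : ℝ → ℝ} {C R : ℝ}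
    (hC0 : 0 ≤ C) (hκ : Continuous κ)
    (hC : ∀ z, |κ z| ≤ C) (hl : ∀ x y, |κ x - κ y| ≤ C * |x - y|)
    (hR : ∀ t, ∫ y, |u t y| ≤ R) :
    Continuous fun p : ℝ × ℝ => ∫ y, u p.1 y * κ (p.2 - y) := by
  rw [continuous_iff_continuousAt]
  rintro ⟨t, x⟩
  rw [ContinuousAt, tendsto_iff_dist_tendsto_zero]
  have l1 : Tendsto (fun p : ℝ × ℝ => C * (∫ y, |u p.1 y - u t y|) + C * R * |p.2 - x|)
      (𝓝 (t, x)) (𝓝 0) := by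
    have a1 : Tendsto (fun p : ℝ × ℝ => ∫ y, |u p.1 y - u t y|) (𝓝 (t, x)) (𝓝 0) :=
      (hu.cont t).comp (continuous_fst.tendsto (t, x))
    have a2 : Tendsto (fun p : ℝ × ℝ => |p.2 - x|) (𝓝 (t, x)) (𝓝 0) := by
      have : Continuous fun p : ℝ × ℝ => |p.2 - x| := by fun_prop
      simpa using this.tendsto (t, x)
    simpa using (a1.const_mul C).add (a2.const_mul (C * R))
  refine squeeze_zero (fun _ => dist_nonneg) (fun p => ?_) l1
  rw [Real.dist_eq]
  exact conv_diff (hu.int p.1) (hu.int t) hC0 hκ hC hl (hR t) _ _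

lemma conv_deriv {u : ℝ → ℝ} (hu : Integrable u) {κ κd : ℝ → ℝ} {C : ℝ}
    (hκ : ∀ z, HasDerivAt κ (κd z) z) (hκdc : Continuous κd) (hC0 : ∀ z, |κ z| ≤ C)
    (hC : ∀ z, |κd z| ≤ C) (x : ℝ) :
    HasDerivAt (fun z => ∫ y, u y * κ (z - y)) (∫ y, u y * κd (x - y)) x := by
  have hκc : Continuous κ := continuous_iff_continuousAt.2 fun z => (hκ z).continuousAt
  refine (hasDerivAt_integral_of_dominated_loc_of_deriv_le
    (F := fun z y => u y * κ (z - y))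
    (F' := fun z y => u y * κd (z - y)) (bound := fun y => |u y| * C)
    (s := univ) univ_mem ?_ ?_ ?_ ?_ ?_ ?_).2
  · refine Eventually.of_forall fun z => ?_
    exact hu.aestronglyMeasurable.mul
      (by fun_prop : Continuous fun y => κ (z - y)).aestronglyMeasurable
  · exact int_mul_bdd hu (by fun_prop : Continuous fun y => κ (x - y)) fun y => hC0 _
  · exact hu.aestronglyMeasurable.mul
      (by fun_prop : Continuous fun y => κd (x - y)).aestronglyMeasurable
  · refine Eventually.of_forall fun y z _ => ?_
    rw [Real.norm_eq_abs, abs_mul]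
    exact mul_le_mul_of_nonneg_left (hC _) (abs_nonneg _)
  · exact hu.abs.mul_const C
  · refine Eventually.of_forall fun y z _ => ?_
    exact ((hκ (z - y)).comp_sub_const z y).const_mul _

section V
variable {n : ℕ} {V W : ℝ → (Fin n → ℝ) → ℝ} {C ε : ℝ}

lemma fd_apply (V : ℝ → (Fin n → ℝ) → ℝ) (p v : ℝ × (Fin n → ℝ)) :
    fderiv ℝ (Function.uncurry V) p v
      = iteratedFDeriv ℝ 1 (Function.uncurry V) p (fun _ => v) := by
  rw [iteratedFDeriv_one_apply]

lemma V_diff (h : VBound n V C) : Differentiable ℝ (Function.uncurry V) :=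
  h.1.differentiable (by simp)

lemma V_fd (h : VBound n V C) (p : ℝ × (Fin n → ℝ)) :
    ‖fderiv ℝ (Function.uncurry V) p‖ ≤ C := by
  have := h.2.2 1 le_rfl (by norm_num) p
  rwa [norm_iteratedFDeriv_one] at this

lemma V_lip (h : VBound n V C) (p q : ℝ × (Fin n → ℝ)) :
    |V p.1 p.2 - V q.1 q.2| ≤ C * ‖p - q‖ := by
  have := Convex.norm_image_sub_le_of_norm_fderiv_le (𝕜 := ℝ) (f := Function.uncurry V) (C := C)
    (s := univ) (fun x _ => V_diff h x) (fun x _ => V_fd h x) convex_univ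
    (mem_univ q) (mem_univ p)
  exact this

lemma V_fd_lip (h : VBound n V C) (p q : ℝ × (Fin n → ℝ)) :
    ‖fderiv ℝ (Function.uncurry V) p - fderiv ℝ (Function.uncurry V) q‖ ≤ C * ‖p - q‖ := by
  refine Convex.norm_image_sub_le_of_norm_fderiv_le (𝕜 := ℝ)
    (f := fderiv ℝ (Function.uncurry V)) (C := C)
    (s := univ) (fun x _ => ?_) (fun x _ => ?_) convex_univ (mem_univ q) (mem_univ p)
  · have : ContDiff ℝ 1 (fderiv ℝ (Function.uncurry V)) :=
      h.1.fderiv_right (by norm_num)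
    exact this.differentiable (by simp) x
  · have := h.2.2 2 (by norm_num) (by norm_num) x
    rw [← norm_iteratedFDeriv_fderiv, norm_iteratedFDeriv_one] at this
    exact this

lemma VD_fd (h : VDistLE n V W ε) (hε : 0 ≤ ε) (p : ℝ × (Fin n → ℝ)) :
    ‖fderiv ℝ (Function.uncurry V) p - fderiv ℝ (Function.uncurry W) p‖ ≤ ε := by
  refine ContinuousLinearMap.opNorm_le_bound _ hε fun v => ?_
  have h1 := h.2 1 le_rfl (by norm_num) p
  have h2 := ContinuousMultilinearMap.le_of_opNorm_le h1 (fun _ => v)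
  rw [ContinuousLinearMap.sub_apply, fd_apply, fd_apply]
  simpa using h2

lemma VD_val (hV : VBound n V C) (hW : VBound n W C) (h : VDistLE n V W ε) (hε : 0 ≤ ε)
    (p : ℝ × (Fin n → ℝ)) : |V p.1 p.2 - W p.1 p.2| ≤ ε + ε * ‖p‖ := by
  have h1 := Convex.norm_image_sub_le_of_norm_fderiv_le (𝕜 := ℝ)
    (f := fun q => Function.uncurry V q - Function.uncurry W q) (C := ε)
    (s := univ) (fun x _ => (V_diff hV x).sub (V_diff hW x))
    (fun x _ => by
      rw [fderiv_fun_sub (V_diff hV x) (V_diff hW x)]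
      exact VD_fd h hε x) convex_univ (mem_univ (p.1, (0 : Fin n → ℝ))) (mem_univ p)
  have h2 := h.1 p.1
  have h3 : ‖p - (p.1, (0 : Fin n → ℝ))‖ ≤ ‖p‖ := by
    rw [Prod.norm_def, Prod.norm_def]; simp
  have h4 := mul_le_mul_of_nonneg_left h3 hε
  simp only [Function.uncurry, Real.norm_eq_abs] at h1
  have h5 : V p.1 p.2 - W p.1 p.2 = (V p.1 0 - W p.1 0)
    + (V p.1 p.2 - W p.1 p.2 - (V p.1 0 - W p.1 0)) := by ring
  rw [h5]
  exact (abs_add_le _ _).trans (add_le_add h2 (h1.trans h4))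

end V

section V2
variable {n : ℕ} {V : ℝ → ℝ → (Fin n → ℝ) → ℝ} {C : ℝ}

lemma Vt_cont (hV : ∀ t, VBound n (V t) C)
    (hc : ∀ t, ∀ ε > (0:ℝ), ∃ δ > (0:ℝ), ∀ s, |s - t| < δ → VDistLE n (V s) (V t) ε) :
    Continuous fun q : ℝ × (ℝ × (Fin n → ℝ)) => V q.1 q.2.1 q.2.2 := by
  rw [continuous_iff_continuousAt]
  rintro ⟨t, p⟩
  have k1 : Tendsto (fun q : ℝ × (ℝ × (Fin n → ℝ)) => V q.1 q.2.1 q.2.2 - V q.1 p.1 p.2)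
      (𝓝 (t, p)) (𝓝 0) := by
    apply squeeze_zero_norm (a := fun q => C * ‖q.2 - p‖) (fun q => V_lip (hV q.1) q.2 p)
    have : Continuous fun q : ℝ × (ℝ × (Fin n → ℝ)) => C * ‖q.2 - p‖ := by fun_prop
    simpa using this.tendsto (t, p)
  have k2 : Tendsto (fun s => V s p.1 p.2) (𝓝 t) (𝓝 (V t p.1 p.2)) := by
    rw [Metric.tendsto_nhds]
    intro ε hε
    have hp : 0 < 1 + ‖p‖ := by positivity
    obtain ⟨δ, hδ, h⟩ := hc t (ε / 2 / (1 + ‖p‖)) (by positivity)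
    filter_upwards [Metric.ball_mem_nhds t hδ] with s hs
    have := VD_val (hV s) (hV t) (h s hs) (by positivity) p
    rw [Real.dist_eq]
    have e : ε / 2 / (1 + ‖p‖) + ε / 2 / (1 + ‖p‖) * ‖p‖ = ε / 2 := by field_simp
    linarith
  have k3 := k1.add (k2.comp (continuous_fst.tendsto (t, p)))
  simpa [ContinuousAt] using k3

lemma Vt_fd_cont (hV : ∀ t, VBound n (V t) C)
    (hc : ∀ t, ∀ ε > (0:ℝ), ∃ δ > (0:ℝ), ∀ s, |s - t| < δ → VDistLE n (V s) (V t) ε) :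
    Continuous fun q : ℝ × (ℝ × (Fin n → ℝ)) => fderiv ℝ (Function.uncurry (V q.1)) q.2 := by
  rw [continuous_iff_continuousAt]
  rintro ⟨t, p⟩
  have k1 : Tendsto (fun q : ℝ × (ℝ × (Fin n → ℝ)) => fderiv ℝ (Function.uncurry (V q.1)) q.2
      - fderiv ℝ (Function.uncurry (V q.1)) p)
      (𝓝 (t, p)) (𝓝 0) := by
    apply squeeze_zero_norm (a := fun q => C * ‖q.2 - p‖) (fun q => V_fd_lip (hV q.1) q.2 p)
    have : Continuous fun q : ℝ × (ℝ × (Fin n → ℝ)) => C * ‖q.2 - p‖ := by fun_prop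
    simpa using this.tendsto (t, p)
  have k2 : Tendsto (fun s => fderiv ℝ (Function.uncurry (V s)) p) (𝓝 t)
      (𝓝 (fderiv ℝ (Function.uncurry (V t)) p)) := by
    rw [Metric.tendsto_nhds]
    intro ε hε
    obtain ⟨δ, hδ, h⟩ := hc t (ε / 2) (by positivity)
    filter_upwards [Metric.ball_mem_nhds t hδ] with s hs
    have := VD_fd (h s hs) (by positivity) p
    rw [dist_eq_norm]
    linarith
  have k3 := k1.add (k2.comp (continuous_fst.tendsto (t, p)))
  simpa [ContinuousAt] using k3

lemma mk_VF (hC : 0 ≤ C) (hV : ∀ t, VBound n (V t) C)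
    (hc : ∀ t, ∀ ε > (0:ℝ), ∃ δ > (0:ℝ), ∀ s, |s - t| < δ → VDistLE n (V s) (V t) ε)
    {η : Fin n → ℝ → ℝ} {Cη R : ℝ} (hCη : 0 ≤ Cη) (hR0 : 0 ≤ R)
    (hη : ∀ j, W2infBound (η j) Cη) {r : ℝ → ℝ → Fin n → ℝ}
    (hr : ∀ j, L1C fun t x => r t x j) (hR : ∀ t j, ∫ x, |r t x j| ≤ R) :
    ∃ wx, VF (fun t x => V t x (fun j => ∫ y, r t y j * η j (x - y))) wx
      (C + C * (Cη * R)) (C * (1 + Cη * R))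
      (C * (1 + Cη * R) ^ 2 + C * (Cη * R)) := by
  have hη1 : ∀ j z, HasDerivAt (η j) (deriv (η j) z) z := fun j z =>
    ((hη j).1.differentiable (by simp) z).hasDerivAt
  have hη1c : ∀ j, ContDiff ℝ 1 (deriv (η j)) := fun j => by
    have := (hη j).1
    rw [show (2 : WithTop ℕ∞) = 1 + 1 by norm_num, contDiff_succ_iff_deriv] at this
    exact this.2.2
  have hη2 : ∀ j z, HasDerivAt (deriv (η j)) (deriv (deriv (η j)) z) z := fun j z =>
    ((hη1c j).differentiable (by simp) z).hasDerivAt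
  have b0 := fun j z => ((hη j).2 z).1
  have b1 := fun j z => ((hη j).2 z).2.1
  have b2 := fun j z => ((hη j).2 z).2.2
  have l0 := fun j => lip_of_deriv (hη1 j) (b1 j)
  have l1 := fun j => lip_of_deriv (hη2 j) (b2 j)
  have c0 := fun j => (hη j).1.continuous
  have c1 := fun j => (hη1c j).continuous
  set S := Cη * R with hS
  have hS0 : 0 ≤ S := mul_nonneg hCη hR0
  let c : ℝ → ℝ → Fin n → ℝ := fun t x j => ∫ y, r t y j * η j (x - y)
  let cx : ℝ → ℝ → Fin n → ℝ := fun t x j => ∫ y, r t y j * deriv (η j) (x - y)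
  have cC : Continuous (Function.uncurry c) :=
    continuous_pi fun j => conv_cont (hr j) hCη (c0 j) (b0 j) (l0 j) (fun t => hR t j)
  have cxC : Continuous (Function.uncurry cx) :=
    continuous_pi fun j => conv_cont (hr j) hCη (c1 j) (b1 j) (l1 j) (fun t => hR t j)
  have cB : ∀ t x, ‖c t x‖ ≤ S := fun t x => (pi_norm_le_iff_of_nonneg hS0).2 fun j =>
    conv_bd ((hr j).int t) hCη (b0 j) (hR t j) x
  have cxB : ∀ t x, ‖cx t x‖ ≤ S := fun t x => (pi_norm_le_iff_of_nonneg hS0).2 fun j =>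
    conv_bd ((hr j).int t) hCη (b1 j) (hR t j) x
  have cL : ∀ t x y, ‖c t x - c t y‖ ≤ S * |x - y| := fun t x y =>
    (pi_norm_le_iff_of_nonneg (by positivity)).2 fun j => by
      have := conv_diff ((hr j).int t) ((hr j).int t) hCη (c0 j) (b0 j) (l0 j) (hR t j) x y
      simpa using this
  have cxL : ∀ t x y, ‖cx t x - cx t y‖ ≤ S * |x - y| := fun t x y =>
    (pi_norm_le_iff_of_nonneg (by positivity)).2 fun j => by
      have := conv_diff ((hr j).int t) ((hr j).int t) hCη (c1 j) (b1 j) (l1 j) (hR t j) x y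
      simpa using this
  have cD : ∀ t x, HasDerivAt (c t) (cx t x) x := fun t x =>
    hasDerivAt_pi.2 fun j => conv_deriv ((hr j).int t) (hη1 j) (c1 j) (b0 j) (b1 j) x
  have PL : ∀ t x y, ‖((x, c t x) : ℝ × (Fin n → ℝ)) - (y, c t y)‖ ≤ (1 + S) * |x - y| := by
    intro t x y
    rw [Prod.norm_def]
    apply max_le
    · simp only [Prod.fst_sub, Real.norm_eq_abs]
      nlinarith [abs_nonneg (x - y)]
    · have := cL t x y
      simp only [Prod.snd_sub]
      nlinarith [abs_nonneg (x - y)]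
  have dB : ∀ t x, ‖((1, cx t x) : ℝ × (Fin n → ℝ))‖ ≤ 1 + S := by
    intro t x
    rw [Prod.norm_def]
    have := cxB t x
    apply max_le
    · simp; exact hS0
    · simp only; linarith
  have dL : ∀ t x y, ‖((1, cx t x) : ℝ × (Fin n → ℝ)) - (1, cx t y)‖ ≤ S * |x - y| := by
    intro t x y
    rw [Prod.norm_def]
    have := cxL t x y
    apply max_le
    · simp; positivity
    · simpa using this
  refine ⟨fun t x => fderiv ℝ (Function.uncurry (V t)) (x, c t x) (1, cx t x), ?_, ?_, ?_, ?_, ?_, ?_⟩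
  · intro t x
    have h1 := (V_diff (hV t) (x, c t x)).hasFDerivAt
    have h2 : HasDerivAt (fun x => ((x, c t x) : ℝ × (Fin n → ℝ))) (1, cx t x) x :=
      (hasDerivAt_id x).prodMk (cD t x)
    exact h1.comp_hasDerivAt x h2
  · exact (Vt_cont hV hc).comp (by fun_prop : Continuous fun q : ℝ × ℝ =>
      ((q.1, q.2, Function.uncurry c q) : ℝ × (ℝ × (Fin n → ℝ))))
  · have := (Vt_fd_cont hV hc).comp (by fun_prop : Continuous fun q : ℝ × ℝ =>
      ((q.1, q.2, Function.uncurry c q) : ℝ × (ℝ × (Fin n → ℝ))))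
    exact this.clm_apply (by fun_prop : Continuous fun q : ℝ × ℝ =>
      (((1:ℝ), Function.uncurry cx q) : ℝ × (Fin n → ℝ)))
  · intro t x
    have h1 := (hV t).2.1 x
    have h2 := V_lip (hV t) (x, c t x) (x, 0)
    have h3 : ‖((x, c t x) : ℝ × (Fin n → ℝ)) - (x, 0)‖ ≤ S := by
      rw [Prod.norm_def]; simpa using cB t x
    have h4 := mul_le_mul_of_nonneg_left h3 hC
    have e : V t x (c t x) = V t x 0 + (V t x (c t x) - V t x 0) := by ring
    show |V t x (c t x)| ≤ _
    rw [e]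
    exact (abs_add_le _ _).trans (add_le_add h1 (h2.trans h4))
  · intro t x
    rw [← Real.norm_eq_abs]
    refine (ContinuousLinearMap.le_opNorm _ _).trans ?_
    exact mul_le_mul (V_fd (hV t) _) (dB t x) (norm_nonneg _) hC
  · intro t x y
    set A := fderiv ℝ (Function.uncurry (V t)) (x, c t x)
    set A' := fderiv ℝ (Function.uncurry (V t)) (y, c t y)
    have e : A (1, cx t x) - A' (1, cx t y)
        = (A - A') (1, cx t x) + A' ((1, cx t x) - (1, cx t y)) := by
      rw [map_sub]; simp
    show |A (1, cx t x) - A' (1, cx t y)| ≤ _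
    rw [e, ← Real.norm_eq_abs]
    refine (norm_add_le _ _).trans ?_
    have h1 : ‖(A - A') (1, cx t x)‖ ≤ (C * ((1 + S) * |x - y|)) * (1 + S) := by
      refine (ContinuousLinearMap.le_opNorm _ _).trans ?_
      refine mul_le_mul ?_ (dB t x) (norm_nonneg _) (by positivity)
      exact (V_fd_lip (hV t) _ _).trans (mul_le_mul_of_nonneg_left (PL t x y) hC)
    have h2 : ‖A' ((1, cx t x) - (1, cx t y))‖ ≤ C * (S * |x - y|) := by
      refine (ContinuousLinearMap.le_opNorm _ _).trans ?_
      exact mul_le_mul (V_fd (hV t) _) (dL t x y) (norm_nonneg _) hC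
    calc _ ≤ _ := add_le_add h1 h2
      _ = _ := by ring

end V2
end Fields

section Fin
open Filter Topology

def cl (t0 T t : ℝ) : ℝ := max t0 (min T t)

lemma cl_mem {t0 T : ℝ} (h : t0 ≤ T) (t : ℝ) : cl t0 T t ∈ Icc t0 T :=
  ⟨le_max_left _ _, max_le h (min_le_left _ _)⟩

lemma cl_eq {t0 T t : ℝ} (h : t ∈ Icc t0 T) : cl t0 T t = t := by
  rw [cl, min_eq_right h.2, max_eq_right h.1]

lemma cl_lip (t0 T s t : ℝ) : |cl t0 T s - cl t0 T t| ≤ |s - t| := by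
  unfold cl
  refine (abs_max_sub_max_le_max _ _ _ _).trans ?_
  rw [sub_self, abs_zero]
  refine max_le (abs_nonneg _) ((abs_min_sub_min_le_max _ _ _ _).trans ?_)
  simp

lemma L1C.norm_cont {u : ℝ → ℝ → ℝ} (hu : L1C u) : Continuous fun t => ∫ x, |u t x| := by
  rw [continuous_iff_continuousAt]
  intro t
  rw [ContinuousAt, tendsto_iff_dist_tendsto_zero]
  refine squeeze_zero (fun _ => dist_nonneg) (fun s => ?_) (hu.cont t)
  rw [Real.dist_eq, ← integral_sub (hu.int s).abs (hu.int t).abs]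
  refine (abs_integral_le_integral_abs).trans ?_
  exact integral_mono ((hu.int s).abs.sub (hu.int t).abs).abs ((hu.int s).sub (hu.int t)).abs
    fun x => abs_abs_sub_abs_le _ _

lemma cl_L1C {n : ℕ} {t0 T : ℝ} (h0 : t0 ≤ T) {ρ : ℝ → ℝ → Fin n → ℝ} (h : ContL1 n t0 T ρ)
    (j : Fin n) : L1C fun t x => ρ (cl t0 T t) x j := by
  have hi : ∀ t, Integrable fun x => ρ (cl t0 T t) x := fun t => h.1 _ (cl_mem h0 t)
  refine ⟨fun t => (hi t).eval j, fun t => ?_⟩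
  rw [Metric.tendsto_nhds]
  intro ε hε
  obtain ⟨δ, hδ, hd⟩ := h.2 (cl t0 T t) (cl_mem h0 t) (ε / 2) (by positivity)
  filter_upwards [Metric.ball_mem_nhds t hδ] with s hs
  have h1 := hd (cl t0 T s) (cl_mem h0 s) ((cl_lip _ _ _ _).trans_lt hs)
  have h2 : ∫ x, |ρ (cl t0 T s) x j - ρ (cl t0 T t) x j| ≤
      ∫ x, ‖ρ (cl t0 T s) x - ρ (cl t0 T t) x‖ :=
    integral_mono (((hi s).eval j).sub ((hi t).eval j)).abs ((hi s).sub (hi t)).norm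
      fun x => norm_le_pi_norm (ρ (cl t0 T s) x - ρ (cl t0 T t) x) j
  have h3 : 0 ≤ ∫ x, |ρ (cl t0 T s) x j - ρ (cl t0 T t) x j| :=
    integral_nonneg fun x => abs_nonneg _
  rw [Real.dist_eq, sub_zero, abs_of_nonneg h3]
  linarith

lemma weak_congr {t0 T : ℝ} {w w' u u' : ℝ → ℝ → ℝ} {u0 : ℝ → ℝ}
    (hw : ∀ t ∈ Icc t0 T, w t = w' t) (hu : ∀ t ∈ Icc t0 T, u t = u' t)
    (h : IsWeakSol t0 T w u0 u) : IsWeakSol t0 T w' u0 u' := by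
  intro φ h1 h2 h3
  rw [← h φ h1 h2 h3]
  congr 1
  refine setIntegral_congr_fun measurableSet_Icc fun t ht => ?_
  simp only [hw t ht, hu t ht]

lemma conv_eq {n : ℕ} (η : Fin n → Fin n → ℝ → ℝ) (ρ : ℝ → Fin n → ℝ) (i : Fin n) (x : ℝ) :
    convTerm n η ρ i x = fun j => ∫ y, ρ y j * η i j (x - y) := by
  funext j
  unfold convTerm
  rw [← integral_sub_left_eq_self (fun ξ => η i j ξ * ρ (x - ξ) j) volume x]
  congr 1; funext y
  simp [mul_comm]

theorem main_aux {n : ℕ} (hn : 1 ≤ n) {Cη CV M TVb Tb t0 T : ℝ} (h0 : t0 < T) (hT : T - t0 ≤ Tb)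
    {η : Fin n → Fin n → ℝ → ℝ} {v : ℝ → Fin n → ℝ → (Fin n → ℝ) → ℝ}
    {ρ0 : ℝ → Fin n → ℝ} {ρ : ℝ → ℝ → Fin n → ℝ}
    (hη : EtaBound n η Cη) (hv : VAssumption n t0 T v)
    (hvb : ∀ τ ∈ Icc t0 T, ∀ i : Fin n, VBound n (v τ i) CV)
    (hρ0 : L1BV n ρ0) (hM : L1n n ρ0 ≤ M) (hTV : TVn n ρ0 ≤ TVb)
    (hs : IsSol n t0 T η v ρ0 ρ) {a b : ℝ} (ha : a ∈ Icc t0 T) (hb : b ∈ Icc t0 T) :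
    (∫ x : ℝ, ‖ρ a x - ρ b x‖) ≤ (n * (Real.exp ((CV * (1 + Cη * M)) * Tb) ^ 2 *
      (2 * ((CV + CV * (Cη * M)) * Real.exp ((CV * (1 + Cη * M)) * Tb)) * TVb
      + ((CV * (1 + Cη * M) ^ 2 + CV * (Cη * M)) * (CV + CV * (Cη * M)) *
        Real.exp ((CV * (1 + Cη * M)) * Tb) * Tb + (CV * (1 + Cη * M))) * M))) * |a - b| := by
  have i0 : Fin n := ⟨0, hn⟩
  have hCη : 0 ≤ Cη := (abs_nonneg _).trans ((hη i0 i0).2 0).1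
  have hCV : 0 ≤ CV := (abs_nonneg _).trans ((hvb t0 (left_mem_Icc.2 h0.le) i0).2.1 0)
  have hM0 : 0 ≤ M := (integral_nonneg fun x => norm_nonneg _).trans hM
  let r : ℝ → ℝ → Fin n → ℝ := fun t => ρ (cl t0 T t)
  have hr : ∀ j, L1C fun t x => r t x j := cl_L1C h0.le hs.1
  have hV : ∀ i t, VBound n (v (cl t0 T t) i) CV := fun i t => hvb _ (cl_mem h0.le t) i
  have hc : ∀ i t, ∀ ε > (0:ℝ), ∃ δ > (0:ℝ), ∀ s, |s - t| < δ →
      VDistLE n (v (cl t0 T s) i) (v (cl t0 T t) i) ε := by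
    intro i t ε hε
    obtain ⟨δ, hδ, h⟩ := hv.2 _ (cl_mem h0.le t) ε hε
    exact ⟨δ, hδ, fun s hst => h _ (cl_mem h0.le s) ((cl_lip _ _ _ _).trans_lt hst) i⟩
  have hw : ∀ i, IsWeakSol t0 T (fun t x => v (cl t0 T t) i x
      (fun j => ∫ y, r t y j * η i j (x - y))) (fun x => ρ0 x i) (fun t x => r t x i) := by
    intro i
    refine weak_congr (fun t ht => ?_) (fun t ht => ?_) (hs.2 i)
    · funext x
      simp only [r, cl_eq ht, conv_eq]
    · funext x
      simp only [r, cl_eq ht]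
  have hi0 : ∀ i, Integrable fun x => ρ0 x i := fun i => hρ0.1.eval i
  have hM' : ∀ i, ∫ x, |ρ0 x i| ≤ M := fun i =>
    (integral_mono (hi0 i).abs hρ0.1.norm fun x => norm_le_pi_norm (ρ0 x) i).trans hM
  -- a first, non quantitative bound
  have hb0 : ∀ j, ∃ R, ∀ t, ∫ x, |r t x j| ≤ R := by
    intro j
    obtain ⟨R, hR⟩ := (isCompact_Icc (a := t0) (b := T)).bddAbove_image
      (hr j).norm_cont.continuousOn
    refine ⟨R, fun t => ?_⟩
    have := hR (mem_image_of_mem _ (cl_mem h0.le t))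
    simpa only [r, cl_eq (cl_mem h0.le t)] using this
  choose R hR using hb0
  have hRa : ∀ t j, ∫ x, |r t x j| ≤ ∑ k, |R k| := fun t j =>
    ((hR j t).trans (le_abs_self _)).trans
      (Finset.single_le_sum (f := fun k => |R k|) (fun k _ => abs_nonneg _) (Finset.mem_univ j))
  have hRb : ∀ t j, ∫ x, |r t x j| ≤ M := by
    intro t j
    have hR0 : 0 ≤ ∑ k, |R k| := Finset.sum_nonneg fun k _ => abs_nonneg _
    obtain ⟨wx, hvf⟩ := mk_VF hCV (hV j) (hc j) hCη hR0 (hη j) hr hRa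
    have := lin_L1 hvf (by positivity) (hr j) (hi0 j) h0 (hw j) (cl_mem h0.le t)
    simp only [r, cl_eq (cl_mem h0.le t)] at this
    exact this.trans (hM' j)
  have key : ∀ i, ∫ x, |ρ a x i - ρ b x i| ≤ (Real.exp ((CV * (1 + Cη * M)) * Tb) ^ 2 *
      (2 * ((CV + CV * (Cη * M)) * Real.exp ((CV * (1 + Cη * M)) * Tb)) * TVb
      + ((CV * (1 + Cη * M) ^ 2 + CV * (Cη * M)) * (CV + CV * (Cη * M)) *
        Real.exp ((CV * (1 + Cη * M)) * Tb) * Tb + (CV * (1 + Cη * M))) * M)) * |a - b| := by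
    intro i
    obtain ⟨wx, hvf⟩ := mk_VF hCV (hV i) (hc i) hCη hM0 (hη i) hr hRb
    have hTVi : (eVariationOn (fun x => ρ0 x i) univ).toReal ≤ TVb := by
      refine le_trans (ENNReal.toReal_mono ?_ ?_) hTV
      · unfold TVe
        exact ENNReal.sum_ne_top.2 fun k _ => hρ0.2 k
      · exact Finset.single_le_sum (f := fun k => eVariationOn (fun x => ρ0 x k) univ)
          (fun k _ => bot_le) (Finset.mem_univ i)
    have := lin_lip hvf (by positivity) (by positivity) (by positivity) (hr i) (hi0 i) (hρ0.2 i)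
      h0 (hw i) (hM' i) hTVi hT ha hb
    simpa only [r, cl_eq ha, cl_eq hb] using this
  have ia : ∀ i, Integrable fun x => ρ a x i := fun i => (hs.1.1 a ha).eval i
  have ib : ∀ i, Integrable fun x => ρ b x i := fun i => (hs.1.1 b hb).eval i
  have h1 : (∫ x : ℝ, ‖ρ a x - ρ b x‖) ≤ ∫ x, ∑ i, |ρ a x i - ρ b x i| := by
    refine integral_mono ((hs.1.1 a ha).sub (hs.1.1 b hb)).norm
      (integrable_finsetSum _ fun i _ => ((ia i).sub (ib i)).abs) fun x => ?_
    refine (pi_norm_le_iff_of_nonneg (Finset.sum_nonneg fun k _ => abs_nonneg _)).2 fun i => ?_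
    exact Finset.single_le_sum (f := fun k => |ρ a x k - ρ b x k|) (fun k _ => abs_nonneg _)
      (Finset.mem_univ i)
  refine h1.trans ?_
  have h2 : ∀ i, Integrable fun x => |ρ a x i - ρ b x i| := fun i => ((ia i).sub (ib i)).abs
  rw [integral_finsetSum _ fun i _ => h2 i]
  refine (Finset.sum_le_sum fun i _ => key i).trans (le_of_eq ?_)
  rw [Finset.sum_const, Finset.card_univ, Fintype.card_fin, nsmul_eq_mul]
  ring

end Fin

/-- (𝒫4), local Lipschitz continuity in time: the solution of the nonlocal
system is Lipschitz in time with values in L¹, with a Lipschitz constant depending only on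
`n`, `‖η‖_{W^{2,∞}}`, `sup ‖v(τ)‖_𝒱ⁿ`, `‖ρ0‖_{L¹}`, `TV(ρ0)` and `T - t0`. -/
theorem statement2 (n : ℕ) (hn : 1 ≤ n) (Cη CV M TVb Tb : ℝ) :
    ∃ C : ℝ, ∀ t0 T : ℝ, 0 ≤ t0 → t0 ≤ T → T - t0 ≤ Tb →
      ∀ (η : Fin n → Fin n → ℝ → ℝ) (v : ℝ → Fin n → ℝ → (Fin n → ℝ) → ℝ)
        (ρ0 : ℝ → Fin n → ℝ) (ρ : ℝ → ℝ → Fin n → ℝ),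
        EtaBound n η Cη →
        VAssumption n t0 T v →
        (∀ τ ∈ Icc t0 T, ∀ i : Fin n, VBound n (v τ i) CV) →
        L1BV n ρ0 → L1n n ρ0 ≤ M → TVn n ρ0 ≤ TVb →
        IsSol n t0 T η v ρ0 ρ →
        ∀ t' ∈ Icc t0 T, ∀ t'' ∈ Icc t0 T,
          (∫ x : ℝ, ‖ρ t' x - ρ t'' x‖) ≤ C * |t' - t''| := by
  refine ⟨n * (Real.exp ((CV * (1 + Cη * M)) * Tb) ^ 2 *
      (2 * ((CV + CV * (Cη * M)) * Real.exp ((CV * (1 + Cη * M)) * Tb)) * TVb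
      + ((CV * (1 + Cη * M) ^ 2 + CV * (Cη * M)) * (CV + CV * (Cη * M)) *
        Real.exp ((CV * (1 + Cη * M)) * Tb) * Tb + (CV * (1 + Cη * M))) * M)),
    fun t0 T _ h0 hT η v ρ0 ρ hη hv hvb hρ0 hM hTV hs a ha b hb => ?_⟩
  rcases h0.lt_or_eq with h | h
  · exact main_aux hn h hT hη hv hvb hρ0 hM hTV hs ha hb
  · have e : a = b := by
      have := ha.1; have := ha.2; have := hb.1; have := hb.2; linarith
    subst e
    simp
end
end

section
/- Let n ≥ 1 and M > 0. Let v: ℝ × ℝⁿ → ℝ be twice continuously differentiable with ∂_x ∇_ρ v, ∇_ρ v and the Hessian D²_{ρρ} v bounded on ℝ × ℝⁿ. Let η ∈ W^{1,∞}(ℝ; ℝⁿ) and r, ρ ∈ L¹(ℝ; ℝⁿ) with ‖r‖_{L¹} ≤ M and ‖ρ‖_{L¹} ≤ M. Then sup_{x∈ℝ} |d/dx[v(x, (η*r)(x))] − d/dx[v(x, (η*ρ)(x))]| ≤ ( ‖∂_x ∇_ρ v‖_∞ ‖η‖_{L∞} + ‖∇_ρ v‖_∞ ‖η'‖_{L∞}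 + M ‖D²_{ρρ} v‖_∞ ‖η‖_{L∞} ‖η'‖_{L∞} ) · ‖r − ρ‖_{L¹(ℝ;ℝⁿ)}. -/
open MeasureTheory Set
open scoped ENNReal NNReal

noncomputable section

/-- Componentwise convolution `(η * ρ)(x) ∈ ℝⁿ`,
`(η * ρ)_j (x) = ∫ η_j(ξ) ρ_j(x - ξ) dξ`, with `ℝⁿ` carrying the Euclidean norm. -/
def econv (n : ℕ) (η ρ : ℝ → EuclideanSpace ℝ (Fin n)) (x : ℝ) :
    EuclideanSpace ℝ (Fin n) :=
  (WithLp.equiv 2 (Fin n → ℝ)).symm fun j => ∫ ξ : ℝ, η ξ j * ρ (x - ξ) j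

/-- Componentwise product as a continuous bilinear map. -/
def hadB (n : ℕ) : EuclideanSpace ℝ (Fin n) →L[ℝ] EuclideanSpace ℝ (Fin n) →L[ℝ]
    EuclideanSpace ℝ (Fin n) :=
  LinearMap.mkContinuous₂
    (LinearMap.mk₂ ℝ (fun a b => WithLp.toLp 2 (fun j => a j * b j))
      (fun a b c => by ext j; simp [add_mul])
      (fun a b c => by ext j; simp [mul_assoc])
      (fun a b c => by ext j; simp [mul_add])
      (fun a b c => by ext j; simp [mul_left_comm])) 1
    (fun a b => by
      rw [one_mul]
      refine abs_le_of_sq_le_sq' ?_ (by positivity) |>.2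
      rw [mul_pow, EuclideanSpace.norm_sq_eq b, EuclideanSpace.norm_sq_eq, Finset.mul_sum]
      refine Finset.sum_le_sum fun j _ => ?_
      simp only [LinearMap.mk₂_apply, norm_mul, mul_pow]
      have := PiLp.norm_apply_le a j
      gcongr)

theorem hadB_apply (n : ℕ) (a b : EuclideanSpace ℝ (Fin n)) (j : Fin n) :
    hadB n a b j = a j * b j := rfl

theorem hadB_le (n : ℕ) (a b : EuclideanSpace ℝ (Fin n)) :
    ‖hadB n a b‖ ≤ ‖a‖ * ‖b‖ := by
  have h := (hadB n).le_opNorm₂ a b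
  have h1 : ‖hadB n‖ ≤ 1 := LinearMap.mkContinuous₂_norm_le _ zero_le_one _
  calc _ ≤ _ := h
    _ ≤ 1 * ‖a‖ * ‖b‖ := by gcongr
    _ = _ := by ring

theorem hadB_integrable (n : ℕ) (g f : ℝ → EuclideanSpace ℝ (Fin n)) (C : ℝ)
    (hg : AEStronglyMeasurable g volume) (hC : ∀ y, ‖g y‖ ≤ C) (hf : Integrable f volume) :
    Integrable (fun y => hadB n (g y) (f y)) volume := by
  refine (hf.norm.const_mul C).mono' ?_ ?_
  · exact (hadB n).aestronglyMeasurable_comp₂ hg hf.1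
  · filter_upwards with y
    refine (hadB_le n _ _).trans ?_
    have := hC y
    gcongr

theorem hadB_integral_le (n : ℕ) (g f : ℝ → EuclideanSpace ℝ (Fin n)) (C : ℝ)
    (hC : ∀ y, ‖g y‖ ≤ C) (hf : Integrable f volume) :
    ‖∫ y, hadB n (g y) (f y)‖ ≤ C * ∫ y, ‖f y‖ := by
  rw [← integral_const_mul]
  refine norm_integral_le_of_norm_le (hf.norm.const_mul C) ?_
  filter_upwards with y
  refine (hadB_le n _ _).trans ?_
  have := hC y
  gcongr

theorem econv_eq (n : ℕ) (η f : ℝ → EuclideanSpace ℝ (Fin n)) (C : ℝ)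
    (hη : Continuous η) (hC : ∀ y, ‖η y‖ ≤ C) (hf : Integrable f volume) (x : ℝ) :
    econv n η f x = ∫ y, hadB n (η (x - y)) (f y) := by
  have hi : Integrable (fun y => hadB n (η (x - y)) (f y)) volume :=
    hadB_integrable n _ f C (by fun_prop) (fun y => hC _) hf
  ext j
  have h1 : (∫ y, hadB n (η (x - y)) (f y)) j = ∫ y, hadB n (η (x - y)) (f y) j :=
    ((EuclideanSpace.proj (𝕜 := ℝ) j).integral_comp_comm hi).symm
  rw [h1]
  simp only [hadB_apply]
  change (∫ ξ : ℝ, η ξ j * f (x - ξ) j) = _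
  rw [← integral_sub_left_eq_self (fun ξ => η ξ j * f (x - ξ) j) volume x]
  simp

theorem econv_deriv (n : ℕ) (η f : ℝ → EuclideanSpace ℝ (Fin n)) (C C' : ℝ)
    (hη : Differentiable ℝ η) (hC : ∀ y, ‖η y‖ ≤ C) (hC' : ∀ y, ‖deriv η y‖ ≤ C')
    (hf : Integrable f volume) (x : ℝ) :
    HasDerivAt (econv n η f) (∫ y, hadB n (deriv η (x - y)) (f y)) x := by
  have he : econv n η f = fun x => ∫ y, hadB n (η (x - y)) (f y) :=
    funext (econv_eq n η f C hη.continuous hC hf)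
  have hc := hη.continuous
  have hm : StronglyMeasurable (deriv η) := stronglyMeasurable_deriv η
  rw [he]
  refine (hasDerivAt_integral_of_dominated_loc_of_deriv_le
    (F := fun x y => hadB n (η (x - y)) (f y))
    (F' := fun x y => hadB n (deriv η (x - y)) (f y))
    (bound := fun y => C' * ‖f y‖) (s := univ) Filter.univ_mem ?_ ?_ ?_ ?_ ?_ ?_).2
  · filter_upwards with z
    exact (hadB_integrable n _ f C (by fun_prop) (fun y => hC _) hf).1
  · exact hadB_integrable n _ f C (by fun_prop) (fun y => hC _) hf
  · refine (hadB_integrable n _ f C' ?_ (fun y => hC' _) hf).1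
    exact (hm.comp_measurable (measurable_const.sub measurable_id)).aestronglyMeasurable
  · filter_upwards with y z _
    refine (hadB_le n _ _).trans ?_
    have := hC' (z - y)
    gcongr
  · exact hf.norm.const_mul C'
  · filter_upwards with y z _
    have h1 : HasDerivAt (fun z => η (z - y)) (deriv η (z - y)) z := by
      have := (hη (z - y)).hasDerivAt
      exact HasDerivAt.comp_sub_const z y this
    have h2 := ((hadB n).flip (f y)).hasFDerivAt.comp_hasDerivAt z h1
    exact h2

/-- Lipschitz estimate for the space derivative in Lemma 4.3:
`sup_x |d/dx v(x,(η*r)(x)) - d/dx v(x,(η*ρ)(x))|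
  ≤ (‖∂ₓ∇_ρ v‖_∞ ‖η‖_∞ + ‖∇_ρ v‖_∞ ‖η'‖_∞ + M ‖D²_{ρρ}v‖_∞ ‖η‖_∞ ‖η'‖_∞) ‖r - ρ‖_{L¹}`. -/
theorem statement13 (n : ℕ) (hn : 1 ≤ n) (M Cxg Cg CH Ce Ce' : ℝ) (hM : 0 < M)
    (v : ℝ → EuclideanSpace ℝ (Fin n) → ℝ)
    (hv : ContDiff ℝ 2 (Function.uncurry v))
    (hvxg : ∀ (x : ℝ) (q : EuclideanSpace ℝ (Fin n)),
      ‖deriv (fun y => fderiv ℝ (v y) q) x‖ ≤ Cxg)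
    (hvg : ∀ (x : ℝ) (q : EuclideanSpace ℝ (Fin n)), ‖fderiv ℝ (v x) q‖ ≤ Cg)
    (hvH : ∀ (x : ℝ) (q : EuclideanSpace ℝ (Fin n)),
      ‖fderiv ℝ (fderiv ℝ (v x)) q‖ ≤ CH)
    (η : ℝ → EuclideanSpace ℝ (Fin n))
    (hηd : Differentiable ℝ η)
    (hηb : ∀ ξ : ℝ, ‖η ξ‖ ≤ Ce)
    (hηb' : ∀ ξ : ℝ, ‖deriv η ξ‖ ≤ Ce')
    (r ρ : ℝ → EuclideanSpace ℝ (Fin n))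
    (hr : Integrable r volume) (hρ : Integrable ρ volume)
    (hrM : (∫ x : ℝ, ‖r x‖) ≤ M) (hρM : (∫ x : ℝ, ‖ρ x‖) ≤ M) :
    ∀ x : ℝ,
      |deriv (fun y => v y (econv n η r y)) x
        - deriv (fun y => v y (econv n η ρ y)) x|
      ≤ (Cxg * Ce + Cg * Ce' + M * CH * Ce * Ce') * ∫ y : ℝ, ‖r y - ρ y‖ := by
  have hD : Differentiable ℝ (Function.uncurry v) := hv.differentiable (by norm_num)
  have hL1 : ContDiff ℝ 1 (fderiv ℝ (Function.uncurry v)) := hv.fderiv_right (by norm_num)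
  have hLD : Differentiable ℝ (fderiv ℝ (Function.uncurry v)) := hL1.differentiable (by norm_num)
  set L := fderiv ℝ (Function.uncurry v) with hL
  -- partial derivative
  have hpart : ∀ y q, fderiv ℝ (v y) q = (L (y, q)).comp (ContinuousLinearMap.inr ℝ ℝ (EuclideanSpace ℝ (Fin n))) := by
    intro y q
    have h1 : HasFDerivAt (fun q : (EuclideanSpace ℝ (Fin n)) => ((y, q) : ℝ × (EuclideanSpace ℝ (Fin n)))) (ContinuousLinearMap.inr ℝ ℝ (EuclideanSpace ℝ (Fin n))) q :=
      hasFDerivAt_prodMk_right y q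
    exact ((hD (y, q)).hasFDerivAt.comp q h1).fderiv
  have hmix : ∀ x q (w : (EuclideanSpace ℝ (Fin n))), deriv (fun y => fderiv ℝ (v y) q) x w
      = fderiv ℝ L (x, q) (1, 0) (0, w) := by
    intro x q w
    have h1 : HasDerivAt (fun y : ℝ => ((y, q) : ℝ × (EuclideanSpace ℝ (Fin n)))) (1, 0) x :=
      (hasDerivAt_id x).prodMk (hasDerivAt_const x q)
    have h2 : HasDerivAt (fun y => L (y, q)) (fderiv ℝ L (x, q) (1, 0)) x :=
      (hLD (x, q)).hasFDerivAt.comp_hasDerivAt x h1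
    have h3 := h2.clm_comp (hasDerivAt_const x (ContinuousLinearMap.inr ℝ ℝ (EuclideanSpace ℝ (Fin n))))
    have h4 : (fun y => fderiv ℝ (v y) q)
      = fun y => (L (y, q)).comp (ContinuousLinearMap.inr ℝ ℝ (EuclideanSpace ℝ (Fin n))) := funext fun y => hpart y q
    rw [h4, h3.deriv]
    simp
  have hsymm : ∀ p a b, fderiv ℝ L p a b = fderiv ℝ L p b a := by
    intro p a b
    exact (hv.contDiffAt.isSymmSndFDerivAt (by simp)).eq a b
  intro x
  have hCe : 0 ≤ Ce := (norm_nonneg _).trans (hηb 0)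
  have hCe' : 0 ≤ Ce' := (norm_nonneg _).trans (hηb' 0)
  have hCxg : 0 ≤ Cxg := (norm_nonneg _).trans (hvxg 0 0)
  have hCg : 0 ≤ Cg := (norm_nonneg _).trans (hvg 0 0)
  have hCH : 0 ≤ CH := (norm_nonneg (fderiv ℝ (fderiv ℝ (v 0)) 0)).trans (hvH 0 0)
  -- Lipschitz bounds
  have hlip1 : ∀ p q : (EuclideanSpace ℝ (Fin n)), |L (x, p) (1, 0) - L (x, q) (1, 0)| ≤ Cxg * ‖p - q‖ := by
    intro p q
    have hd : ∀ q : (EuclideanSpace ℝ (Fin n)), HasFDerivAt (fun q : (EuclideanSpace ℝ (Fin n)) => L (x, q) (1, 0))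
        (deriv (fun y => fderiv ℝ (v y) q) x) q := by
      intro q
      have h1 : HasFDerivAt (fun q : (EuclideanSpace ℝ (Fin n)) => ((x, q) : ℝ × (EuclideanSpace ℝ (Fin n)))) (ContinuousLinearMap.inr ℝ ℝ (EuclideanSpace ℝ (Fin n))) q :=
        hasFDerivAt_prodMk_right x q
      have h2 : HasFDerivAt (fun q : (EuclideanSpace ℝ (Fin n)) => L (x, q)) _ q := (hLD (x, q)).hasFDerivAt.comp q h1
      have h3 := h2.clm_apply (hasFDerivAt_const ((1, 0) : ℝ × (EuclideanSpace ℝ (Fin n))) q)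
      refine h3.congr_fderiv ?_
      refine ContinuousLinearMap.ext fun w => ?_
      rw [hmix, hsymm]
      simp
    have := convex_univ.norm_image_sub_le_of_norm_hasFDerivWithin_le
      (fun z _ => (hd z).hasFDerivWithinAt) (fun z _ => hvxg x z) (mem_univ q) (mem_univ p)
    simpa using this
  have hlip2 : ∀ p q : (EuclideanSpace ℝ (Fin n)), ‖fderiv ℝ (v x) p - fderiv ℝ (v x) q‖ ≤ CH * ‖p - q‖ := by
    intro p q
    have hd : Differentiable ℝ (fderiv ℝ (v x)) := by
      have h4 : fderiv ℝ (v x)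
        = fun q => (L (x, q)).comp (ContinuousLinearMap.inr ℝ ℝ (EuclideanSpace ℝ (Fin n))) := funext fun q => hpart x q
      rw [h4]
      fun_prop
    exact convex_univ.norm_image_sub_le_of_norm_fderiv_le
      (fun z _ => hd z) (fun z _ => hvH x z) (mem_univ q) (mem_univ p)
  -- chain rule
  have hchain : ∀ f : ℝ → (EuclideanSpace ℝ (Fin n)), Integrable f volume →
      deriv (fun y => v y (econv n η f y)) x = L (x, econv n η f x) (1, 0)
        + fderiv ℝ (v x) (econv n η f x) (∫ y, hadB n (deriv η (x - y)) (f y)) := by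
    intro f hf
    have h1 := econv_deriv n η f Ce Ce' hηd hηb hηb' hf x
    have h2 := (hasDerivAt_id x).prodMk h1
    have h3 := ((hD (x, econv n η f x)).hasFDerivAt).comp_hasDerivAt x h2
    have h4 : deriv (fun y => v y (econv n η f y)) x = _ := h3.deriv
    rw [h4, hpart, ContinuousLinearMap.comp_apply, ← map_add]
    simp [hL]
  rw [hchain r hr, hchain ρ hρ]
  have hm : StronglyMeasurable (deriv η) := stronglyMeasurable_deriv η
  have hm' : AEStronglyMeasurable (fun y => deriv η (x - y)) volume :=
    (hm.comp_measurable (measurable_const.sub measurable_id)).aestronglyMeasurable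
  have hc := hηd.continuous
  have e1 : ‖econv n η r x - econv n η ρ x‖ ≤ Ce * ∫ y, ‖r y - ρ y‖ := by
    rw [econv_eq n η r Ce hc hηb hr, econv_eq n η ρ Ce hc hηb hρ, ← integral_sub
      (hadB_integrable n _ r Ce (by fun_prop) (fun y => hηb _) hr)
      (hadB_integrable n _ ρ Ce (by fun_prop) (fun y => hηb _) hρ)]
    simp only [← map_sub]
    exact hadB_integral_le n _ (fun y => r y - ρ y) Ce (fun y => hηb _) (hr.sub hρ)
  have e2 : ‖(∫ y, hadB n (deriv η (x - y)) (r y)) - ∫ y, hadB n (deriv η (x - y)) (ρ y)‖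
      ≤ Ce' * ∫ y, ‖r y - ρ y‖ := by
    rw [← integral_sub
      (hadB_integrable n _ r Ce' hm' (fun y => hηb' _) hr)
      (hadB_integrable n _ ρ Ce' hm' (fun y => hηb' _) hρ)]
    simp only [← map_sub]
    exact hadB_integral_le n _ (fun y => r y - ρ y) Ce' (fun y => hηb' _) (hr.sub hρ)
  have e3 : ‖∫ y, hadB n (deriv η (x - y)) (ρ y)‖ ≤ Ce' * M :=
    (hadB_integral_le n _ ρ Ce' (fun y => hηb' _) hρ).trans (by gcongr)
  set p := econv n η r x
  set q := econv n η ρ x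
  set a := ∫ y, hadB n (deriv η (x - y)) (r y)
  set b := ∫ y, hadB n (deriv η (x - y)) (ρ y)
  set I := ∫ y, ‖r y - ρ y‖
  have hI : 0 ≤ I := integral_nonneg fun y => norm_nonneg _
  have f1 := hlip1 p q
  have f2 : ‖fderiv ℝ (v x) p (a - b)‖ ≤ Cg * (Ce' * I) := by
    refine (ContinuousLinearMap.le_opNorm _ _).trans ?_
    have := hvg x p
    gcongr
  have f3 : ‖(fderiv ℝ (v x) p - fderiv ℝ (v x) q) b‖ ≤ (CH * (Ce * I)) * (Ce' * M) := by
    refine (ContinuousLinearMap.le_opNorm _ _).trans ?_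
    have : ‖fderiv ℝ (v x) p - fderiv ℝ (v x) q‖ ≤ CH * (Ce * I) :=
      (hlip2 p q).trans (by gcongr)
    gcongr
  have f1' : |L (x, p) (1, 0) - L (x, q) (1, 0)| ≤ Cxg * (Ce * I) := f1.trans (by gcongr)
  have hsplit : L (x, p) (1, 0) + fderiv ℝ (v x) p a - (L (x, q) (1, 0) + fderiv ℝ (v x) q b)
      = (L (x, p) (1, 0) - L (x, q) (1, 0)) + fderiv ℝ (v x) p (a - b)
        + (fderiv ℝ (v x) p - fderiv ℝ (v x) q) b := by
    rw [map_sub, ContinuousLinearMap.sub_apply]; ring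
  rw [hsplit]
  rw [Real.norm_eq_abs] at f2 f3
  refine (abs_add_three _ _ _).trans ?_
  calc _ ≤ Cxg * (Ce * I) + Cg * (Ce' * I) + (CH * (Ce * I)) * (Ce' * M) := by gcongr
    _ = _ := by ring
end
end

section
/- Let T > 0, Q̃ > 0 and let w: [0,T] × ℝ → ℝ be continuous with w(t,·) twice continuously differentiable in x, and suppose sup_{t∈[0,T]}(‖w(t,·)‖_{L∞} + ‖∂_x w(t,·)‖_{L∞} + ‖∂²_{xx} w(t,·)‖_{L∞}) ≤ Q̃. Let ρ_o ∈ (L¹ ∩ BV)(ℝ; ℝ) and let ρ be the Lagrangian solution ρ(t, x) = ρ_o(X(0; t, x)) exp(−∫_0^t ∂_x w(s, X(s; t, x)) ds). Then for every t ∈ [0,T]: TV(ρ(t)) ≤ (TV(ρ_o) + Q̃ · t · ‖ρ_o‖_{L¹(ℝ)}) · e^{Q̃ t}. -/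
open MeasureTheory Set
open scoped ENNReal NNReal

lemma sol_mono (T Q : ℝ) (w : ℝ → ℝ → ℝ)
    (hL : ∀ t ∈ Icc (0:ℝ) T, ∀ x y, |w t x - w t y| ≤ Q * |x - y|) (u v : ℝ → ℝ)
    (hu : ∀ t ∈ Icc (0:ℝ) T, HasDerivWithinAt u (w t (u t)) (Icc (0:ℝ) T) t)
    (hv : ∀ t ∈ Icc (0:ℝ) T, HasDerivWithinAt v (w t (v t)) (Icc (0:ℝ) T) t) :
    AntitoneOn (fun s => (u s - v s)^2 * Real.exp (-(2*Q*s))) (Icc (0:ℝ) T) ∧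
    MonotoneOn (fun s => (u s - v s)^2 * Real.exp (2*Q*s)) (Icc (0:ℝ) T) := by
  have hkey : ∀ t ∈ Icc (0:ℝ) T, |(u t - v t) * (w t (u t) - w t (v t))| ≤ Q * (u t - v t)^2 := by
    intro t ht
    rw [abs_mul, ← sq_abs (u t - v t)]
    have := hL t ht (u t) (v t)
    nlinarith [abs_nonneg (u t - v t)]
  have hd : ∀ c : ℝ, ∀ t ∈ Icc (0:ℝ) T, HasDerivWithinAt
      (fun s => (u s - v s)^2 * Real.exp (c*s))
      ((2 * ((u t - v t) * (w t (u t) - w t (v t))) + c * (u t - v t)^2) * Real.exp (c*t))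
      (Icc (0:ℝ) T) t := by
    intro c t ht
    have h1 := (((hu t ht).sub (hv t ht)).pow 2)
    have h2 : HasDerivAt (fun s => Real.exp (c*s)) (Real.exp (c*t) * (c * 1)) t :=
      ((hasDerivAt_id t).const_mul c).exp
    refine (h1.mul h2.hasDerivWithinAt).congr_deriv ?_
    simp
    ring
  have hI : interior (Icc (0:ℝ) T) = Ioo 0 T := interior_Icc
  constructor
  · have hd' := hd (-(2*Q))
    simp only [neg_mul] at hd'
    refine antitoneOn_of_hasDerivWithinAt_nonpos (convex_Icc 0 T)
      (fun t ht => (hd' t ht).continuousWithinAt)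
      (fun t ht => (hd' t (interior_subset ht)).mono interior_subset) ?_
    intro t ht
    have := hkey t (interior_subset ht)
    have := abs_le.1 this
    refine mul_nonpos_of_nonpos_of_nonneg (by linarith) (Real.exp_pos _).le
  · have hd' := hd (2*Q)
    refine monotoneOn_of_hasDerivWithinAt_nonneg (convex_Icc 0 T)
      (fun t ht => (hd' t ht).continuousWithinAt)
      (fun t ht => (hd' t (interior_subset ht)).mono interior_subset) ?_
    intro t ht
    have := hkey t (interior_subset ht)
    have := abs_le.1 this
    refine mul_nonneg (by linarith) (Real.exp_pos _).le

lemma sol_unique (T Q : ℝ) (w : ℝ → ℝ → ℝ)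
    (hL : ∀ t ∈ Icc (0:ℝ) T, ∀ x y, |w t x - w t y| ≤ Q * |x - y|) (u v : ℝ → ℝ)
    (hu : ∀ t ∈ Icc (0:ℝ) T, HasDerivWithinAt u (w t (u t)) (Icc (0:ℝ) T) t)
    (hv : ∀ t ∈ Icc (0:ℝ) T, HasDerivWithinAt v (w t (v t)) (Icc (0:ℝ) T) t)
    (a : ℝ) (ha : a ∈ Icc (0:ℝ) T) (h : u a = v a) : ∀ s ∈ Icc (0:ℝ) T, u s = v s := by
  intro s hs
  obtain ⟨h1, h2⟩ := sol_mono T Q w hL u v hu hv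
  have key : ∀ c : ℝ, (u s - v s)^2 * Real.exp c ≤ 0 → u s = v s := by
    intro c hc
    have h3 : (u s - v s)^2 ≤ 0 := by
      by_contra hh
      push Not at hh
      have := mul_pos hh (Real.exp_pos c)
      linarith
    have : u s - v s = 0 := by
      have := sq_nonneg (u s - v s)
      exact pow_eq_zero_iff (two_ne_zero) |>.1 (le_antisymm h3 this)
    linarith
  rcases le_total a s with has | has
  · have := h1 ha hs has
    simp only [h, sub_self] at this
    exact key _ (by simpa using this)
  · have := h2 hs ha has
    simp only [h, sub_self] at this
    exact key _ (by simpa using this)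

lemma sol_order (T Q : ℝ) (w : ℝ → ℝ → ℝ)
    (hL : ∀ t ∈ Icc (0:ℝ) T, ∀ x y, |w t x - w t y| ≤ Q * |x - y|) (u v : ℝ → ℝ)
    (hu : ∀ t ∈ Icc (0:ℝ) T, HasDerivWithinAt u (w t (u t)) (Icc (0:ℝ) T) t)
    (hv : ∀ t ∈ Icc (0:ℝ) T, HasDerivWithinAt v (w t (v t)) (Icc (0:ℝ) T) t)
    (a : ℝ) (ha : a ∈ Icc (0:ℝ) T) (h : u a ≤ v a) : ∀ s ∈ Icc (0:ℝ) T, u s ≤ v s := by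
  intro s hs
  by_contra hlt
  push Not at hlt
  have hc : ContinuousOn (fun s => v s - u s) (Icc (0:ℝ) T) := fun t ht =>
    ((hv t ht).continuousWithinAt).sub ((hu t ht).continuousWithinAt)
  have hmem : (0:ℝ) ∈ Icc (v s - u s) (v a - u a) := ⟨by linarith, by linarith⟩
  obtain ⟨b, hb, hb0⟩ := isPreconnected_Icc.intermediate_value hs ha hc hmem
  have := sol_unique T Q w hL u v hu hv b hb (by simp only at hb0; linarith) s hs
  linarith

lemma sol_growth (T Q : ℝ) (hT : 0 ≤ T) (w : ℝ → ℝ → ℝ)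
    (hL : ∀ t ∈ Icc (0:ℝ) T, ∀ x y, |w t x - w t y| ≤ Q * |x - y|) (u v : ℝ → ℝ)
    (hu : ∀ t ∈ Icc (0:ℝ) T, HasDerivWithinAt u (w t (u t)) (Icc (0:ℝ) T) t)
    (hv : ∀ t ∈ Icc (0:ℝ) T, HasDerivWithinAt v (w t (v t)) (Icc (0:ℝ) T) t)
    (h : u 0 ≤ v 0) : ∀ s ∈ Icc (0:ℝ) T, v s - u s ≤ (v 0 - u 0) * Real.exp (Q*s) := by
  intro s hs
  have h1 := (sol_mono T Q w hL u v hu hv).1 (left_mem_Icc.2 hT) hs hs.1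
  simp only [mul_zero, neg_zero, Real.exp_zero, mul_one] at h1
  have e : Real.exp (-(2*Q*s)) * (Real.exp (Q*s))^2 = 1 := by
    rw [sq, ← Real.exp_add, ← Real.exp_add]; ring_nf; simp
  have h2 : (v s - u s)^2 ≤ ((v 0 - u 0) * Real.exp (Q*s))^2 := by
    have := mul_le_mul_of_nonneg_right h1 (sq_nonneg (Real.exp (Q*s)))
    rw [mul_assoc, e] at this
    nlinarith
  exact (abs_le_of_sq_le_sq' h2 (mul_nonneg (by linarith) (Real.exp_pos _).le)).2 

lemma flow_step (T Q : ℝ) (hT : 0 ≤ T) (hQ : 0 ≤ Q) (w p : ℝ → ℝ → ℝ)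
    (hL : ∀ t ∈ Icc (0:ℝ) T, ∀ x y, |w t x - w t y| ≤ Q * |x - y|)
    (hp : Continuous (Function.uncurry p))
    (hpQ : ∀ t ∈ Icc (0:ℝ) T, ∀ x, |p t x| ≤ Q)
    (hpL : ∀ t ∈ Icc (0:ℝ) T, ∀ x y, |p t x - p t y| ≤ Q * |x - y|)
    (hwp : ∀ t ∈ Icc (0:ℝ) T, ∀ x y, x ≤ y →
      w t y - w t x ≤ (p t x + Q * (y - x)) * (y - x))
    (u v : ℝ → ℝ)
    (hu : ∀ t ∈ Icc (0:ℝ) T, HasDerivWithinAt u (w t (u t)) (Icc (0:ℝ) T) t)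
    (hv : ∀ t ∈ Icc (0:ℝ) T, HasDerivWithinAt v (w t (v t)) (Icc (0:ℝ) T) t)
    (h : u 0 ≤ v 0) (t : ℝ) (ht : t ∈ Icc (0:ℝ) T) :
    |Real.exp (-∫ s in (0:ℝ)..t, p s (v s)) - Real.exp (-∫ s in (0:ℝ)..t, p s (u s))| ≤
      Q * t * Real.exp (Q * t) * Real.exp (2 * (Q * Real.exp (Q*T) * (v 0 - u 0)) * t)
        * (v 0 - u 0) := by
  have hext : ∀ z : ℝ → ℝ, (∀ t ∈ Icc (0:ℝ) T, HasDerivWithinAt z (w t (z t)) (Icc (0:ℝ) T) t) →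
      ∃ g : ℝ → ℝ, Continuous g ∧ ∀ s ∈ Icc (0:ℝ) T, p s (z s) = g s := by
    intro z hz
    have hzc : ContinuousOn z (Icc (0:ℝ) T) := fun t ht => (hz t ht).continuousWithinAt
    refine ⟨fun s => p s (IccExtend hT ((Icc (0:ℝ) T).domRestrict z) s), ?_, ?_⟩
    · have h1 : Continuous (IccExtend hT ((Icc (0:ℝ) T).domRestrict z)) :=
        (continuousOn_iff_continuous_domRestrict.1 hzc).Icc_extend'
      exact hp.comp (continuous_id.prodMk h1)
    · intro s hs
      simp only
      rw [IccExtend_of_mem hT _ hs]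
      rfl
  obtain ⟨g, hgc, hg⟩ := hext u hu
  obtain ⟨k, hkc, hk⟩ := hext v hv
  have ht0 := ht.1
  have hsub : ∀ s ∈ uIcc 0 t, s ∈ Icc (0:ℝ) T := by
    intro s hs
    rw [uIcc_of_le ht0] at hs
    exact ⟨hs.1, hs.2.trans ht.2⟩
  rw [intervalIntegral.integral_congr (fun s hs => hk s (hsub s hs)),
    intervalIntegral.integral_congr (fun s hs => hg s (hsub s hs))]
  set d := v 0 - u 0 with hd
  have hd0 : 0 ≤ d := by rw [hd]; linarith
  set K := Q * Real.exp (Q*T) * d with hK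
  have hK0 : 0 ≤ K := by positivity
  have hord := sol_order T Q w hL u v hu hv 0 (left_mem_Icc.2 hT) h
  have hgr : ∀ s ∈ Icc (0:ℝ) T, Q * (v s - u s) ≤ K := by
    intro s hs
    have h1 := sol_growth T Q hT w hL u v hu hv h s hs
    have h2 : Real.exp (Q*s) ≤ Real.exp (Q*T) :=
      Real.exp_le_exp.2 (mul_le_mul_of_nonneg_left hs.2 hQ)
    have h3 : v s - u s ≤ Real.exp (Q*T) * d := by
      nlinarith [mul_le_mul_of_nonneg_left h2 hd0]
    rw [hK, mul_assoc]
    exact mul_le_mul_of_nonneg_left h3 hQ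
  -- sharp growth
  have hsharp : ∀ s ∈ Icc (0:ℝ) T,
      v s - u s ≤ d * Real.exp ((∫ r in (0:ℝ)..s, g r) + K * s) := by
    have hF : ∀ s ∈ Icc (0:ℝ) T, HasDerivWithinAt
        (fun s => (v s - u s) * Real.exp (-((∫ r in (0:ℝ)..s, g r) + K * s)))
        (((w s (v s) - w s (u s)) - (v s - u s) * (g s + K)) *
          Real.exp (-((∫ r in (0:ℝ)..s, g r) + K * s))) (Icc (0:ℝ) T) s := by
      intro s hs
      have h1 := (hv s hs).sub (hu s hs)
      have h2 : HasDerivAt (fun s => ∫ r in (0:ℝ)..s, g r) (g s) s :=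
        intervalIntegral.integral_hasDerivAt_right (hgc.intervalIntegrable _ _)
          hgc.aestronglyMeasurable.stronglyMeasurableAtFilter hgc.continuousAt
      have h3 := ((h2.add ((hasDerivAt_id s).const_mul K)).neg).exp
      refine (h1.mul h3.hasDerivWithinAt).congr_deriv ?_
      simp
      ring
    have hanti : AntitoneOn
        (fun s => (v s - u s) * Real.exp (-((∫ r in (0:ℝ)..s, g r) + K * s))) (Icc (0:ℝ) T) := by
      refine antitoneOn_of_hasDerivWithinAt_nonpos (convex_Icc 0 T)
        (fun t ht => (hF t ht).continuousWithinAt)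
        (fun t ht => (hF t (interior_subset ht)).mono interior_subset) ?_
      intro s hs
      have hs := interior_subset hs
      have h1 := hwp s hs _ _ (hord s hs)
      rw [hg s hs] at h1
      have h2 := mul_le_mul_of_nonneg_right (hgr s hs) (sub_nonneg.2 (hord s hs))
      refine mul_nonpos_of_nonpos_of_nonneg (by nlinarith) (Real.exp_pos _).le
    intro s hs
    have h1 := hanti (left_mem_Icc.2 hT) hs hs.1
    simp only [intervalIntegral.integral_same, mul_zero, add_zero, neg_zero, Real.exp_zero,
      mul_one] at h1
    rw [Real.exp_neg, ← div_eq_mul_inv, div_le_iff₀ (Real.exp_pos _)] at h1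
    exact h1
  have hdiff : ∀ s ∈ Icc (0:ℝ) T, |k s - g s| ≤ Q * (v s - u s) := by
    intro s hs
    rw [← hg s hs, ← hk s hs]
    have := hpL s hs (v s) (u s)
    rwa [abs_of_nonneg (sub_nonneg.2 (hord s hs))] at this
  set A := ∫ s in (0:ℝ)..t, g s with hA
  set B := ∫ s in (0:ℝ)..t, k s with hB
  have hBA : B - A = ∫ s in (0:ℝ)..t, (k s - g s) :=
    (intervalIntegral.integral_sub (hkc.intervalIntegrable _ _) (hgc.intervalIntegrable _ _)).symm
  -- crude bound
  have hbound : ∀ C : ℝ, (∀ s ∈ Icc (0:ℝ) t, Q * (v s - u s) ≤ C) → |B - A| ≤ C * t := by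
    intro C hC
    rw [hBA, ← Real.norm_eq_abs]
    have := intervalIntegral.norm_integral_le_of_norm_le_const (a := 0) (b := t)
      (f := fun s => k s - g s) (C := C) (by
        intro s hs
        rw [uIoc_of_le ht0] at hs
        have hs' : s ∈ Icc (0:ℝ) t := ⟨hs.1.le, hs.2⟩
        rw [Real.norm_eq_abs]
        exact (hdiff s ⟨hs'.1, hs'.2.trans ht.2⟩).trans (hC s hs'))
    rwa [sub_zero, abs_of_nonneg ht0] at this
  have hcrude : |B - A| ≤ K * t := hbound K (fun s hs => hgr s ⟨hs.1, hs.2.trans ht.2⟩)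
  have hfine : |B - A| ≤ (Q * (d * Real.exp (A + Q * t + K * t))) * t := by
    apply hbound
    intro s hs
    have hs' : s ∈ Icc (0:ℝ) T := ⟨hs.1, hs.2.trans ht.2⟩
    refine mul_le_mul_of_nonneg_left ((hsharp s hs').trans ?_) hQ
    refine mul_le_mul_of_nonneg_left (Real.exp_le_exp.2 ?_) hd0
    have h1 : (∫ r in (0:ℝ)..s, g r) + ∫ r in s..t, g r = A :=
      intervalIntegral.integral_add_adjacent_intervals (hgc.intervalIntegrable _ _)
        (hgc.intervalIntegrable _ _)
    have h2 := intervalIntegral.norm_integral_le_of_norm_le_const (a := s) (b := t)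
      (f := g) (C := Q) (by
        intro r hr
        rw [uIoc_of_le hs.2] at hr
        have hr' : r ∈ Icc (0:ℝ) T := ⟨hs.1.trans hr.1.le, hr.2.trans ht.2⟩
        rw [Real.norm_eq_abs, ← hg r hr']
        exact hpQ r hr' _)
    rw [Real.norm_eq_abs, abs_of_nonneg (sub_nonneg.2 hs.2)] at h2
    have h3 := (abs_le.1 h2).1
    nlinarith [mul_nonneg hQ hs.1, mul_le_mul_of_nonneg_left hs.2 hK0]
  have hexp : |Real.exp (-B) - Real.exp (-A)| ≤ Real.exp (-A + K * t) * |B - A| := by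
    have hc := abs_le.1 hcrude
    have e1 : Real.exp (-B) ≤ Real.exp (-A + K*t) := Real.exp_le_exp.2 (by linarith)
    have e2 : Real.exp (-A) ≤ Real.exp (-A + K*t) := Real.exp_le_exp.2 (by nlinarith)
    have f1 : Real.exp (-B) * (B - A + 1) ≤ Real.exp (-A) := by
      have := Real.add_one_le_exp (B - A)
      calc _ ≤ Real.exp (-B) * Real.exp (B - A) :=
            mul_le_mul_of_nonneg_left this (Real.exp_pos _).le
        _ = _ := by rw [← Real.exp_add]; ring_nf
    have f2 : Real.exp (-A) * (A - B + 1) ≤ Real.exp (-B) := by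
      have := Real.add_one_le_exp (A - B)
      calc _ ≤ Real.exp (-A) * Real.exp (A - B) :=
            mul_le_mul_of_nonneg_left this (Real.exp_pos _).le
        _ = _ := by rw [← Real.exp_add]; ring_nf
    have g1 := mul_le_mul_of_nonneg_right e1 (abs_nonneg (B - A))
    have g2 := mul_le_mul_of_nonneg_right e2 (abs_nonneg (B - A))
    have k1 := mul_le_mul_of_nonneg_left (neg_abs_le (B - A)) (Real.exp_pos (-B)).le
    have k2 := mul_le_mul_of_nonneg_left (le_abs_self (B - A)) (Real.exp_pos (-A)).le
    rw [abs_le]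
    constructor <;> nlinarith
  refine hexp.trans ((mul_le_mul_of_nonneg_left hfine (Real.exp_pos _).le).trans (le_of_eq ?_))
  have : Real.exp (Q * t) * Real.exp (2 * K * t)
      = Real.exp (-A + K * t) * Real.exp (A + Q * t + K * t) := by
    rw [← Real.exp_add, ← Real.exp_add]; ring_nf
  calc _ = Q * t * (Real.exp (-A + K * t) * Real.exp (A + Q * t + K * t)) * d := by ring
    _ = _ := by rw [← this]; ring

lemma lip_of_local (f : ℝ → ℝ) (L C : ℝ)
    (h : ∀ a b, a ≤ b → |f b - f a| ≤ L * Real.exp (C * (b - a)) * (b - a)) :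
    ∀ a b, a ≤ b → |f b - f a| ≤ L * (b - a) := by
  intro a b hab
  have key : ∀ n : ℕ, |f b - f a| ≤ L * Real.exp (C * ((b - a) * (1/((n:ℝ)+1)))) * (b - a) := by
    intro n
    have hn : (0:ℝ) < (n:ℝ) + 1 := by positivity
    set δ := (b - a) * (1/((n:ℝ)+1)) with hδ
    have hδ0 : 0 ≤ δ := mul_nonneg (sub_nonneg.2 hab) (by positivity)
    have h1 : f b - f a = ∑ i ∈ Finset.range (n+1),
        (f (a + ((i+1:ℕ):ℝ) * δ) - f (a + (i:ℝ) * δ)) := by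
      rw [Finset.sum_range_sub (fun i : ℕ => f (a + (i:ℝ) * δ))]
      have : a + ((n+1:ℕ):ℝ) * δ = b := by
        rw [hδ]; push_cast; field_simp; ring
      rw [this]; simp
    rw [h1]
    refine (Finset.abs_sum_le_sum_abs _ _).trans ?_
    have h2 : ∀ i ∈ Finset.range (n+1),
        |f (a + ((i+1:ℕ):ℝ) * δ) - f (a + (i:ℝ) * δ)| ≤ L * Real.exp (C * δ) * δ := by
      intro i _
      have := h (a + (i:ℝ) * δ) (a + ((i+1:ℕ):ℝ) * δ) (by push_cast; nlinarith)
      have e : a + ((i+1:ℕ):ℝ) * δ - (a + (i:ℝ) * δ) = δ := by push_cast; ring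
      rwa [e] at this
    refine (Finset.sum_le_sum h2).trans (le_of_eq ?_)
    have : ((n:ℝ)+1) * δ = b - a := by rw [hδ]; field_simp
    simp only [Finset.sum_const, Finset.card_range, nsmul_eq_mul]
    push_cast
    rw [← this]; ring
  have hlim : Filter.Tendsto (fun n : ℕ => L * Real.exp (C * ((b - a) * (1/((n:ℝ)+1)))) * (b - a))
      Filter.atTop (nhds (L * Real.exp (C * ((b - a) * 0)) * (b - a))) := by
    have := tendsto_one_div_add_atTop_nhds_zero_nat (𝕜 := ℝ)
    exact (((Real.continuous_exp.tendsto _).comp ((this.const_mul (b - a)).const_mul C)).const_mul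
      L).mul_const (b - a)
  have := ge_of_tendsto' hlim key
  simpa using this

lemma tv_mul (ρ E : ℝ → ℝ) (M L : ℝ) (hM : 0 ≤ M) (hL : 0 ≤ L) (hρ : Integrable ρ volume)
    (hE : ∀ x, |E x| ≤ M) (hEL : ∀ a b, a ≤ b → |E b - E a| ≤ L * (b - a)) :
    eVariationOn (fun x => ρ x * E x) univ ≤
      ENNReal.ofReal M * eVariationOn ρ univ + ENNReal.ofReal (L * ∫ x, |ρ x|) := by
  have hi : ∀ a b, IntervalIntegrable (fun x => |ρ x|) volume a b := fun a b =>
    hρ.abs.intervalIntegrable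
  have step : ∀ a b, a ≤ b → edist (ρ b * E b) (ρ a * E a) ≤
      ENNReal.ofReal M * eVariationOn ρ (Icc a b) + ENNReal.ofReal (L * ∫ x in a..b, |ρ x|) := by
    intro a b hab
    rcases hab.eq_or_lt with rfl | hlt
    · simp
    obtain ⟨c, hc, hcle⟩ : ∃ c ∈ Icc a b, |ρ c| * (b - a) ≤ ∫ x in a..b, |ρ x| := by
      obtain ⟨c, hc, h⟩ := exists_le_setAverage (μ := volume) (s := Ioc a b)
        (f := fun x => |ρ x|) (by simp [hlt]) (by simp) hρ.abs.integrableOn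
      refine ⟨c, Ioc_subset_Icc_self hc, ?_⟩
      rw [setAverage_eq, ← intervalIntegral.integral_of_le hab] at h
      simp only [Measure.real, Real.volume_Ioc, smul_eq_mul,
        ENNReal.toReal_ofReal (sub_nonneg.2 hab)] at h
      rwa [inv_mul_eq_div, le_div_iff₀ (sub_pos.2 hlt)] at h
    have h1 : |ρ b * E b - ρ a * E a| ≤
        M * (|ρ b - ρ c| + |ρ c - ρ a|) + L * ∫ x in a..b, |ρ x| := by
      have e : ρ b * E b - ρ a * E a
        = (ρ b - ρ c) * E b + ρ c * (E b - E a) + (ρ c - ρ a) * E a := by ring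
      rw [e]
      refine (abs_add_three _ _ _).trans ?_
      rw [abs_mul, abs_mul, abs_mul]
      have k1 := mul_le_mul_of_nonneg_left (hE b) (abs_nonneg (ρ b - ρ c))
      have k2 := mul_le_mul_of_nonneg_left (hE a) (abs_nonneg (ρ c - ρ a))
      have k3 := mul_le_mul_of_nonneg_left (hEL a b hab) (abs_nonneg (ρ c))
      have k4 := mul_le_mul_of_nonneg_left hcle hL
      nlinarith
    have h2 : ENNReal.ofReal (|ρ b - ρ c| + |ρ c - ρ a|) ≤ eVariationOn ρ (Icc a b) := by
      rw [ENNReal.ofReal_add (abs_nonneg _) (abs_nonneg _), ← Real.dist_eq, ← Real.dist_eq,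
        ← edist_dist, ← edist_dist]
      have := eVariationOn.Icc_add_Icc ρ (s := univ) hc.1 hc.2 (mem_univ c)
      simp only [univ_inter] at this
      rw [← this, add_comm]
      exact add_le_add
        (eVariationOn.edist_le ρ (right_mem_Icc.2 hc.1) (left_mem_Icc.2 hc.1))
        (eVariationOn.edist_le ρ (right_mem_Icc.2 hc.2) (left_mem_Icc.2 hc.2))
    rw [edist_dist, Real.dist_eq]
    refine (ENNReal.ofReal_le_ofReal h1).trans ((ENNReal.ofReal_add_le).trans ?_)
    rw [ENNReal.ofReal_mul hM]
    gcongr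
  refine iSup_le ?_
  rintro ⟨n, u, hu, -⟩
  simp only
  refine (Finset.sum_le_sum (fun i _ => step (u i) (u (i+1)) (hu (Nat.le_succ i)))).trans ?_
  rw [Finset.sum_add_distrib, ← Finset.mul_sum]
  have hnn : ∀ a b, a ≤ b → 0 ≤ L * ∫ x in a..b, |ρ x| := fun a b hab =>
    mul_nonneg hL (intervalIntegral.integral_nonneg hab (fun _ _ => abs_nonneg _))
  gcongr
  · rw [eVariationOn.sum' ρ hu]
    exact eVariationOn.mono ρ (subset_univ _)
  · rw [← ENNReal.ofReal_sum_of_nonneg (fun i _ => hnn _ _ (hu (Nat.le_succ i))),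
      ← Finset.mul_sum, intervalIntegral.sum_integral_adjacent_intervals (fun k _ => hi _ _)]
    refine ENNReal.ofReal_le_ofReal (mul_le_mul_of_nonneg_left ?_ hL)
    rw [intervalIntegral.integral_of_le (hu (Nat.zero_le n))]
    exact setIntegral_le_integral hρ.abs (Filter.Eventually.of_forall fun _ => abs_nonneg _)

lemma lip_of_deriv_s17 (f : ℝ → ℝ) (Q : ℝ) (hf : Differentiable ℝ f) (h : ∀ x, |deriv f x| ≤ Q) :
    ∀ x y, |f x - f y| ≤ Q * |x - y| := by
  intro x y
  have := Convex.norm_image_sub_le_of_norm_deriv_le (f := f) (C := Q) (s := univ) (x := y) (y := x)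
    (fun z _ => hf z) (fun z _ => h z) convex_univ (mem_univ _) (mem_univ _)
  simpa [Real.norm_eq_abs] using this


/-- equation (4.16): total variation bound for Lagrangian solutions:
if `sup_t (‖w(t)‖_∞ + ‖∂ₓw(t)‖_∞ + ‖∂²ₓₓw(t)‖_∞) ≤ Q̃` then the Lagrangian solution
`ρ(t,x) = ρ0(X(0;t,x)) exp(-∫₀ᵗ ∂ₓw(s, X(s;t,x)) ds)` satisfies
`TV(ρ(t)) ≤ (TV(ρ0) + Q̃ t ‖ρ0‖_{L¹}) e^{Q̃ t}`. -/
theorem statement17 (T Qt : ℝ) (hT : 0 < T) (hQ : 0 < Qt)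
    (w : ℝ → ℝ → ℝ)
    (hw_cont : Continuous (Function.uncurry w))
    (hw_smooth : ∀ t : ℝ, ContDiff ℝ 2 (w t))
    (hwx_cont : Continuous fun p : ℝ × ℝ => deriv (w p.1) p.2)
    (hwxx_cont : Continuous fun p : ℝ × ℝ => deriv (deriv (w p.1)) p.2)
    (hwQ : ∀ t ∈ Icc (0:ℝ) T, ∀ x : ℝ,
      |w t x| + |deriv (w t) x| + |deriv (deriv (w t)) x| ≤ Qt)
    (X : ℝ → ℝ → ℝ → ℝ)
    (hX0 : ∀ t0 ∈ Icc (0:ℝ) T, ∀ x0 : ℝ, X t0 t0 x0 = x0)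
    (hX : ∀ t0 ∈ Icc (0:ℝ) T, ∀ x0 : ℝ, ∀ t ∈ Icc (0:ℝ) T,
      HasDerivWithinAt (fun s => X s t0 x0) (w t (X t t0 x0)) (Icc (0:ℝ) T) t)
    (ρ0 : ℝ → ℝ) (hρ0 : Integrable ρ0 volume)
    (hbv : BoundedVariationOn ρ0 Set.univ) :
    ∀ t ∈ Icc (0:ℝ) T,
      eVariationOn
          (fun x => ρ0 (X 0 t x) * Real.exp (-∫ s in (0:ℝ)..t, deriv (w s) (X s t x)))
          Set.univ
        ≤ (eVariationOn ρ0 Set.univ + ENNReal.ofReal (Qt * t * ∫ x : ℝ, |ρ0 x|))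
            * ENNReal.ofReal (Real.exp (Qt * t)) := by
  have hd1 : ∀ t, Differentiable ℝ (w t) := fun t => (hw_smooth t).differentiable (by norm_num)
  have hd2 : ∀ t, Differentiable ℝ (deriv (w t)) := fun t =>
    ((contDiff_succ_iff_deriv (n := 1)).1 (hw_smooth t)).2.2.differentiable (by norm_num)
  have hp1 : ∀ t ∈ Icc (0:ℝ) T, ∀ x, |deriv (w t) x| ≤ Qt := fun t ht x => by
    have := hwQ t ht x
    linarith [abs_nonneg (w t x), abs_nonneg (deriv (deriv (w t)) x)]
  have hp2 : ∀ t ∈ Icc (0:ℝ) T, ∀ x, |deriv (deriv (w t)) x| ≤ Qt := fun t ht x => by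
    have := hwQ t ht x
    linarith [abs_nonneg (w t x), abs_nonneg (deriv (w t) x)]
  have hL : ∀ t ∈ Icc (0:ℝ) T, ∀ x y, |w t x - w t y| ≤ Qt * |x - y| := fun t ht =>
    lip_of_deriv_s17 _ _ (hd1 t) (hp1 t ht)
  have hpL : ∀ t ∈ Icc (0:ℝ) T, ∀ x y, |deriv (w t) x - deriv (w t) y| ≤ Qt * |x - y| :=
    fun t ht => lip_of_deriv_s17 _ _ (hd2 t) (hp2 t ht)
  have hwp : ∀ t ∈ Icc (0:ℝ) T, ∀ x y, x ≤ y →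
      w t y - w t x ≤ (deriv (w t) x + Qt * (y - x)) * (y - x) := by
    intro t ht x y hxy
    rcases hxy.eq_or_lt with rfl | hlt
    · simp
    obtain ⟨c, hc, he⟩ := exists_deriv_eq_slope (w t) hlt (hd1 t).continuous.continuousOn
      (hd1 t).differentiableOn
    rw [eq_div_iff (sub_pos.2 hlt).ne'] at he
    rw [← he]
    refine mul_le_mul_of_nonneg_right ?_ (sub_nonneg.2 hxy)
    have h1 := (abs_le.1 (hpL t ht c x)).2
    rw [abs_of_nonneg (by linarith [hc.1])] at h1
    nlinarith [hc.2]
  intro t ht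
  have h0 : (0:ℝ) ∈ Icc (0:ℝ) T := left_mem_Icc.2 hT.le
  set E : ℝ → ℝ := fun y => Real.exp (-∫ s in (0:ℝ)..t, deriv (w s) (X s 0 y)) with hE
  have hELip : ∀ a b, a ≤ b → |E b - E a| ≤ Qt * t * Real.exp (Qt * t) * (b - a) := by
    refine lip_of_local E _ (2 * (Qt * Real.exp (Qt*T)) * t) ?_
    intro a b hab
    have := flow_step T Qt hT.le hQ.le w (fun s => deriv (w s)) hL hwx_cont hp1 hpL hwp
      (fun s => X s 0 a) (fun s => X s 0 b) (hX 0 h0 a) (hX 0 h0 b)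
      (by simp only [hX0 0 h0]; exact hab) t ht
    simp only [hX0 0 h0] at this
    refine this.trans (le_of_eq ?_)
    ring_nf
  have hEM : ∀ y, |E y| ≤ Real.exp (Qt * t) := by
    intro y
    rw [hE, abs_of_pos (Real.exp_pos _)]
    refine Real.exp_le_exp.2 ?_
    have h2 := intervalIntegral.norm_integral_le_of_norm_le_const (a := 0) (b := t)
      (f := fun s => deriv (w s) (X s 0 y)) (C := Qt) (by
        intro r hr
        rw [uIoc_of_le ht.1] at hr
        exact hp1 r ⟨hr.1.le, hr.2.trans ht.2⟩ _)
    rw [Real.norm_eq_abs, sub_zero, abs_of_nonneg ht.1] at h2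
    linarith [(abs_le.1 h2).1]
  have heq : (fun x => ρ0 (X 0 t x) * Real.exp (-∫ s in (0:ℝ)..t, deriv (w s) (X s t x)))
      = (fun y => ρ0 y * E y) ∘ (fun x => X 0 t x) := by
    funext x
    simp only [Function.comp, hE]
    congr 3
    refine intervalIntegral.integral_congr (fun s hs => ?_)
    rw [uIcc_of_le ht.1] at hs
    have := sol_unique T Qt w hL (fun s => X s t x) (fun s => X s 0 (X 0 t x)) (hX t ht x)
      (hX 0 h0 _) 0 h0 (by simp only [hX0 0 h0]) s ⟨hs.1, hs.2.trans ht.2⟩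
    exact congrArg (deriv (w s)) this
  have hmono : Monotone (fun x => X 0 t x) := by
    intro x y hxy
    exact sol_order T Qt w hL (fun s => X s t x) (fun s => X s t y) (hX t ht x) (hX t ht y) t ht
      (by simp only [hX0 t ht]; exact hxy) 0 h0
  rw [heq]
  refine (eVariationOn.comp_le_of_monotoneOn _ (s := univ) _ (hmono.monotoneOn _)
    (fun _ _ => mem_univ _)).trans ?_
  have hc : 0 ≤ Qt * t * Real.exp (Qt * t) :=
    mul_nonneg (mul_nonneg hQ.le ht.1) (Real.exp_pos _).le
  refine (tv_mul ρ0 E _ _ (Real.exp_pos _).le hc hρ0 hEM hELip).trans (le_of_eq ?_)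
  rw [add_mul, mul_comm (eVariationOn ρ0 univ), ← ENNReal.ofReal_mul
    (mul_nonneg (mul_nonneg hQ.le ht.1) (integral_nonneg fun _ => abs_nonneg _))]
  congr 2
  ring
end
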